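/- arXiv:1902.00552 — 4 statements merged into one kernel-verified Lean document; each statement's English description precedes it below -/
import Mathlib

section
/- There exist real numbers μ and a_1, …, a_14 such that the 8 × 8 symmetric matrix G(μ, a_1, …, a_14) satisfies: (i) rank(G) = 3, (ii) G is positive semidefinite, (iii) 0.6 ≤ μ ≤ 0.64759, and (iv) |a_j| < μ for all 1 ≤ j ≤ 14. -/
/-- The `8 × 8` symmetric matrix `G(μ, a₁, …, a₁₄)` from the paper. -/
def packingGram (μ a1 a2 a3 a4 a5 a6 a7 a8 a9 a10 a11 a12 a13 a14 : ℝ) :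
    Matrix (Fin 8) (Fin 8) ℝ :=
  !![1,  a1,  μ,  a2,  a3, -μ,  a4, -μ;
     a1, 1,  -μ,  a5, -μ,  a6, -μ,  a7;
     μ, -μ,   1,   μ,  a8, -μ,  a9, a10;
     a2, a5,  μ,   1, a11, a12,  μ,   μ;
     a3, -μ, a8, a11,   1,   μ,  μ,  -μ;
     -μ, a6, -μ, a12,   μ,   1,  μ, a13;
     a4, -μ, a9,   μ,   μ,   μ,  1, a14;
     -μ, a7, a10,  μ,  -μ, a13, a14,  1]

noncomputable section

open scoped Matrix

/-- Vectors of three-dimensional space, as triples. -/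
abbrev V3 := ℝ × ℝ × ℝ

/-- Dot product. -/
def dt (u v : V3) : ℝ := u.1 * v.1 + u.2.1 * v.2.1 + u.2.2 * v.2.2

def thL (m : ℝ) (u v : V3) : ℝ := m / (1 + dt u v)

def thG (m : ℝ) (u v : V3) : ℝ :=
  Real.sqrt ((1 + dt u v - 2 * m ^ 2) / ((1 + dt u v) ^ 2 * (1 - dt u v)))

/-- The unit vector with inner product `m` with both `u` and `v` (one of the two choices). -/
def th (m : ℝ) (u v : V3) : V3 :=
  (thL m u v * (u.1 + v.1) + thG m u v * (u.2.1 * v.2.2 - u.2.2 * v.2.1),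
   thL m u v * (u.2.1 + v.2.1) + thG m u v * (u.2.2 * v.1 - u.1 * v.2.2),
   thL m u v * (u.2.2 + v.2.2) + thG m u v * (u.1 * v.2.1 - u.2.1 * v.1))

/-- Nondegeneracy conditions for `th`. -/
def Good (m : ℝ) (u v : V3) : Prop :=
  0 < 1 + dt u v ∧ 0 < 1 - dt u v ∧ 0 < 1 + dt u v - 2 * m ^ 2

theorem th_spec (m : ℝ) (u v : V3) (hu : dt u u = 1) (hv : dt v v = 1) (h : Good m u v) :
    dt (th m u v) (th m u v) = 1 ∧ dt (th m u v) u = m ∧ dt (th m u v) v = m := by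
  obtain ⟨h1, h2, h3⟩ := h
  have hl : thL m u v * (1 + dt u v) = m := by
    unfold thL; field_simp
  have hg : thG m u v ^ 2 * ((1 + dt u v) ^ 2 * (1 - dt u v)) = 1 + dt u v - 2 * m ^ 2 := by
    unfold thG
    rw [Real.sq_sqrt (by positivity)]
    field_simp
  generalize hL : thL m u v = L at *
  generalize hG : thG m u v = g at *
  generalize hc : dt u v = c at *
  have e1 : dt (th m u v) (th m u v) = L ^ 2 * (dt u u + dt v v + 2 * dt u v)
      + g ^ 2 * (dt u u * dt v v - dt u v ^ 2) := by
    simp only [th, hL, hG, dt]; ring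
  have e2 : dt (th m u v) u = L * (dt u u + dt u v) := by
    simp only [th, hL, hG, dt]; ring
  have e3 : dt (th m u v) v = L * (dt v v + dt u v) := by
    simp only [th, hL, hG, dt]; ring
  rw [hu, hc] at e2
  rw [hv, hc] at e3
  rw [hu, hv, hc] at e1
  refine ⟨?_, by rw [e2, hl], by rw [e3]; linarith⟩
  rw [e1]
  have h4 : (1 + c) * (L ^ 2 * (1 + 1 + 2 * c) + g ^ 2 * (1 * 1 - c ^ 2)) = (1 + c) * 1 := by
    have : (1 + c) * (L ^ 2 * (1 + 1 + 2 * c) + g ^ 2 * (1 * 1 - c ^ 2))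
      = 2 * (L * (1 + c)) ^ 2 + g ^ 2 * ((1 + c) ^ 2 * (1 - c)) := by ring
    rw [this, hg, hl]; ring
  exact mul_left_cancel₀ h1.ne' h4

theorem th_cont (S : Set ℝ) (u v : ℝ → V3) (hu : ContinuousOn u S) (hv : ContinuousOn v S)
    (h : ∀ m ∈ S, Good m (u m) (v m)) : ContinuousOn (fun m => th m (u m) (v m)) S := by
  have hd : ContinuousOn (fun m => dt (u m) (v m)) S := by
    unfold dt; fun_prop
  have hL : ContinuousOn (fun m => thL m (u m) (v m)) S := by
    unfold thL
    exact continuousOn_id.div (by fun_prop) (fun m hm => (h m hm).1.ne')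
  have hG : ContinuousOn (fun m => thG m (u m) (v m)) S := by
    unfold thG
    refine Real.continuous_sqrt.comp_continuousOn (ContinuousOn.div (by fun_prop) (by fun_prop) ?_)
    intro m hm
    obtain ⟨h1, h2, -⟩ := h m hm
    positivity
  unfold th
  fun_prop

/-- Componentwise closeness. -/
def NV (u : V3) (a b c e : ℝ) : Prop := |u.1 - a| ≤ e ∧ |u.2.1 - b| ≤ e ∧ |u.2.2 - c| ≤ e

theorem NV.mono {u : V3} {a b c e f : ℝ} (h : NV u a b c e) (hf : e ≤ f) : NV u a b c f :=
  ⟨h.1.trans hf, h.2.1.trans hf, h.2.2.trans hf⟩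

theorem NV.neg {u : V3} {a b c e : ℝ} (h : NV u a b c e) : NV (-u) (-a) (-b) (-c) e := by
  obtain ⟨h1, h2, h3⟩ := h
  refine ⟨?_, ?_, ?_⟩
  · rw [← abs_neg]; convert h1 using 2; simp; ring
  · rw [← abs_neg]; convert h2 using 2; simp; ring
  · rw [← abs_neg]; convert h3 using 2; simp; ring

theorem mul_near {x y a b e f A B : ℝ} (hx : |x - a| ≤ e) (hy : |y - b| ≤ f)
    (ha : |a| ≤ A) (hb : |b| ≤ B) : |x * y - a * b| ≤ A * f + B * e + e * f := by
  have h : x * y - a * b = a * (y - b) + b * (x - a) + (x - a) * (y - b) := by ring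
  rw [h]
  refine (abs_add_three _ _ _).trans ?_
  rw [abs_mul, abs_mul, abs_mul]
  have : 0 ≤ e := (abs_nonneg _).trans hx
  have : 0 ≤ A := (abs_nonneg _).trans ha
  have : 0 ≤ B := (abs_nonneg _).trans hb
  gcongr

theorem add_near {x y a b e f : ℝ} (hx : |x - a| ≤ e) (hy : |y - b| ≤ f) :
    |(x + y) - (a + b)| ≤ e + f := by
  have h : (x + y) - (a + b) = (x - a) + (y - b) := by ring
  rw [h]
  exact (abs_add_le _ _).trans (add_le_add hx hy)

theorem sub_near {x y a b e f : ℝ} (hx : |x - a| ≤ e) (hy : |y - b| ≤ f) :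
    |(x - y) - (a - b)| ≤ e + f := by
  have h : (x - y) - (a - b) = (x - a) - (y - b) := by ring
  rw [h]
  exact (abs_sub _ _).trans (add_le_add hx hy)

theorem near_trans {x a b e f : ℝ} (hx : |x - a| ≤ e) (h : |a - b| ≤ f) : |x - b| ≤ e + f :=
  (abs_sub_le x a b).trans (add_le_add hx h)

theorem abs_le_near {x a e A : ℝ} (hx : |x - a| ≤ e) (ha : |a| ≤ A) : |x| ≤ A + e := by
  have : x = a + (x - a) := by ring
  rw [this]
  exact (abs_add_le _ _).trans (add_le_add ha hx)

/-- The reference coordinates are at most one in absolute value. -/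
def U3 (a b c : ℝ) : Prop := |a| ≤ 1 ∧ |b| ≤ 1 ∧ |c| ≤ 1

theorem U3.neg {a b c : ℝ} (h : U3 a b c) : U3 (-a) (-b) (-c) := by
  simpa [U3] using h

theorem dt_near {u v : V3} {a1 a2 a3 b1 b2 b3 e : ℝ}
    (hu : NV u a1 a2 a3 e) (hv : NV v b1 b2 b3 e) (ha : U3 a1 a2 a3) (hb : U3 b1 b2 b3)
    (he : e ≤ 1 / 100) : |dt u v - (a1 * b1 + a2 * b2 + a3 * b3)| ≤ 7 * e := by
  have he0 : 0 ≤ e := (abs_nonneg _).trans hu.1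
  have h := add_near (add_near (mul_near hu.1 hv.1 ha.1 hb.1)
    (mul_near hu.2.1 hv.2.1 ha.2.1 hb.2.1)) (mul_near hu.2.2 hv.2.2 ha.2.2 hb.2.2)
  refine h.trans ?_
  nlinarith

theorem comp_near {l g p q r s t w a b c d L0 G0 w0 e δ : ℝ}
    (he : e ≤ 1 / 10000) (hδ : δ ≤ e)
    (hl : |l - L0| ≤ 15 * e) (hg : |g - G0| ≤ 300 * e) (hL : |L0| ≤ 1) (hG : |G0| ≤ 1)
    (hp : |p - a| ≤ e) (hq : |q - b| ≤ e) (hr : |r - c| ≤ e) (hs : |s - d| ≤ e)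
    {ap bp : ℝ} (ht : |t - ap| ≤ e) (hw : |w - bp| ≤ e)
    (ha : |a| ≤ 1) (hb : |b| ≤ 1) (hc : |c| ≤ 1) (hd : |d| ≤ 1) (hap : |ap| ≤ 1) (hbp : |bp| ≤ 1)
    (h0 : |L0 * (ap + bp) + G0 * (a * b - c * d) - w0| ≤ δ) :
    |l * (t + w) + g * (p * q - r * s) - w0| ≤ 1000 * e := by
  have he0 : 0 ≤ e := (abs_nonneg _).trans hp
  have hx : |ap + bp| ≤ 2 := (abs_add_le _ _).trans (by linarith)
  have hy : |a * b - c * d| ≤ 2 := by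
    refine (abs_sub _ _).trans ?_
    rw [abs_mul, abs_mul]
    have := mul_le_one₀ ha (abs_nonneg b) hb
    have := mul_le_one₀ hc (abs_nonneg d) hd
    linarith
  have h := near_trans (add_near (mul_near hl (add_near ht hw) hL hx)
    (mul_near hg (sub_near (mul_near hp hq ha hb) (mul_near hr hs hc hd)) hG hy)) h0
  refine h.trans ?_
  nlinarith [mul_nonneg he0 he0, mul_nonneg (mul_nonneg he0 he0) he0]

theorem cubic_lower {c : ℝ} (h1 : -(11 / 100) ≤ c) (h2 : c ≤ 71 / 100) :
    8 / 10 ≤ (1 + c) ^ 2 * (1 - c) := by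
  nlinarith [mul_nonneg (mul_nonneg (show 0 ≤ c + 11 / 100 by linarith)
    (show 0 ≤ 71 / 100 - c by linarith)) (show 0 ≤ c + 16 / 10 by linarith)]

theorem cubic_near {c c0 e : ℝ} (hcc : |c - c0| ≤ 8 * e) (c1 : -(1 / 10) ≤ c0)
    (c2 : c0 ≤ 7 / 10) (h1 : -(11 / 100) ≤ c) (h2 : c ≤ 71 / 100) :
    |(1 + c) ^ 2 * (1 - c) - (1 + c0) ^ 2 * (1 - c0)| ≤ 40 * e := by
  have he : 0 ≤ 8 * e := (abs_nonneg _).trans hcc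
  have e1 : (1 + c) ^ 2 * (1 - c) - (1 + c0) ^ 2 * (1 - c0)
    = (c - c0) * (1 - (c + c0) - (c ^ 2 + c * c0 + c0 ^ 2)) := by ring
  have q1 : c ^ 2 ≤ 1 := by nlinarith
  have q2 : c0 ^ 2 ≤ 1 := by nlinarith
  have e2 : |1 - (c + c0) - (c ^ 2 + c * c0 + c0 ^ 2)| ≤ 5 := by
    rw [abs_le]
    constructor <;> nlinarith only [sq_nonneg (c + c0), sq_nonneg (c - c0), q1, q2, c1, c2, h1, h2]
  rw [e1, abs_mul]
  calc _ ≤ (8 * e) * 5 := by gcongr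
    _ = _ := by ring

theorem root_near {g g0 D D0 N N0 e : ℝ} (he0 : 0 ≤ e) (hpos : 24 / 100 ≤ (g + g0) * D)
    (hgs : g ^ 2 * D = N) (hN : |N - N0| ≤ 13 * e) (hg : |N0 - g0 ^ 2 * D0| ≤ e)
    (hD : |D - D0| ≤ 40 * e) (g1 : 0 ≤ g0) (g2 : g0 ≤ 1) : |g - g0| ≤ 300 * e := by
  have hkey : |(g - g0) * ((g + g0) * D)| ≤ 54 * e := by
    have h1 : (g - g0) * ((g + g0) * D) = (N - N0)
      + (N0 - g0 ^ 2 * D0) - g0 ^ 2 * (D - D0) := by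
      rw [← hgs]; ring
    have h2 : |g0 ^ 2 * (D - D0)| ≤ 1 * (40 * e) := by
      rw [abs_mul, abs_of_nonneg (sq_nonneg g0)]
      gcongr
      nlinarith only [g1, g2]
    rw [h1]
    have h3 := abs_le.1 h2
    have h4 := abs_le.1 hN
    have h5 := abs_le.1 hg
    rw [abs_le]
    constructor <;> linarith
  rw [abs_mul, abs_of_pos (show 0 < (g + g0) * D by linarith)] at hkey
  nlinarith only [abs_nonneg (g - g0), hkey, hpos, he0]

theorem th_near {m m0 c0 l0 g0 e δ : ℝ} {u v : V3} {a1 a2 a3 b1 b2 b3 w1 w2 w3 : ℝ}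
    (hu : NV u a1 a2 a3 e) (hv : NV v b1 b2 b3 e) (hm : |m - m0| ≤ e)
    (ha : U3 a1 a2 a3) (hb : U3 b1 b2 b3) (he : e ≤ 1 / 10000) (hδ : δ ≤ e)
    (m1 : 0 ≤ m0) (m2 : m0 ≤ 1) (c1 : -(1 / 10) ≤ c0) (c2 : c0 ≤ 7 / 10)
    (l1 : 0 ≤ l0) (l2 : l0 ≤ 1) (g1 : 3 / 10 ≤ g0) (g2 : g0 ≤ 1)
    (hN : 1 / 10 ≤ 1 + c0 - 2 * m0 ^ 2)
    (hc : |a1 * b1 + a2 * b2 + a3 * b3 - c0| ≤ δ)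
    (hl : |m0 - l0 * (1 + c0)| ≤ δ)
    (hg : |1 + c0 - 2 * m0 ^ 2 - g0 ^ 2 * ((1 + c0) ^ 2 * (1 - c0))| ≤ δ)
    (hw1 : |l0 * (a1 + b1) + g0 * (a2 * b3 - a3 * b2) - w1| ≤ δ)
    (hw2 : |l0 * (a2 + b2) + g0 * (a3 * b1 - a1 * b3) - w2| ≤ δ)
    (hw3 : |l0 * (a3 + b3) + g0 * (a1 * b2 - a2 * b1) - w3| ≤ δ) :
    Good m u v ∧ NV (th m u v) w1 w2 w3 (1000 * e) := by
  have he0 : 0 ≤ e := (abs_nonneg _).trans hu.1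
  have hcc : |dt u v - c0| ≤ 8 * e := by
    have := near_trans (dt_near hu hv ha hb (by linarith)) hc
    linarith
  have hN' : |(1 + dt u v - 2 * m ^ 2) - (1 + c0 - 2 * m0 ^ 2)| ≤ 13 * e := by
    have h1 : |m * m - m0 * m0| ≤ 1 * e + 1 * e + e * e :=
      mul_near hm hm (abs_le.2 ⟨by linarith, m2⟩) (abs_le.2 ⟨by linarith, m2⟩)
    rw [abs_le] at *
    constructor <;> nlinarith
  have hGood : Good m u v := by
    rw [abs_le] at hcc hN'
    refine ⟨by linarith, by linarith, by linarith⟩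
  refine ⟨hGood, ?_⟩
  obtain ⟨p1, p2, p3⟩ := hGood
  have hc' := abs_le.1 hcc
  have hL : |thL m u v - l0| ≤ 15 * e := by
    have h1 : thL m u v - l0 = (m - l0 * (1 + dt u v)) / (1 + dt u v) := by
      unfold thL; field_simp
    rw [h1, abs_div, abs_of_pos p1, div_le_iff₀ p1]
    have h2 : m - l0 * (1 + dt u v)
      = (m - m0) + (m0 - l0 * (1 + c0)) - l0 * (dt u v - c0) := by ring
    have h3 : |l0 * (dt u v - c0)| ≤ 1 * (8 * e) := by
      rw [abs_mul, abs_of_nonneg l1]; gcongr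
    rw [h2]
    have h4 := abs_le.1 h3
    have h5 := abs_le.1 hm
    have h6 := abs_le.1 hl
    rw [abs_le]
    constructor <;> nlinarith
  have hG : |thG m u v - g0| ≤ 300 * e := by
    have hg0 : 0 ≤ thG m u v := Real.sqrt_nonneg _
    have hgs : thG m u v ^ 2 * ((1 + dt u v) ^ 2 * (1 - dt u v)) = 1 + dt u v - 2 * m ^ 2 := by
      unfold thG
      rw [Real.sq_sqrt (by positivity)]
      field_simp
    generalize thG m u v = g at *
    generalize dt u v = c at *
    have hD : |(1 + c) ^ 2 * (1 - c) - (1 + c0) ^ 2 * (1 - c0)| ≤ 40 * e :=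
      cubic_near hcc c1 c2 (by linarith) (by linarith)
    have hDl : 8 / 10 ≤ (1 + c) ^ 2 * (1 - c) := cubic_lower (by linarith) (by linarith)
    generalize (1 + c) ^ 2 * (1 - c) = D at *
    generalize (1 + c0) ^ 2 * (1 - c0) = D0 at *
    have hpos : 24 / 100 ≤ (g + g0) * D := by nlinarith only [hDl, hg0, g1]
    exact root_near he0 hpos hgs hN' (hg.trans hδ) hD (by linarith) g2
  have hl0 : |l0| ≤ 1 := abs_le.2 ⟨by linarith, l2⟩
  have hg0 : |g0| ≤ 1 := abs_le.2 ⟨by linarith, g2⟩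
  obtain ⟨u1, u2, u3⟩ := hu
  obtain ⟨v1, v2, v3⟩ := hv
  obtain ⟨A1, A2, A3⟩ := ha
  obtain ⟨B1, B2, B3⟩ := hb
  exact ⟨comp_near he hδ hL hG hl0 hg0 u2 v3 u3 v2 u1 v1 A2 B3 A3 B2 A1 B1 hw1,
    comp_near he hδ hL hG hl0 hg0 u3 v1 u1 v3 u2 v2 A3 B1 A1 B3 A2 B2 hw2,
    comp_near he hδ hL hG hl0 hg0 u1 v2 u2 v1 u3 v3 A1 B2 A2 B1 A3 B3 hw3⟩

def gramRows (v1 v2 v3 v4 v5 v6 v7 v8 : V3) : Matrix (Fin 8) (Fin 3) ℝ :=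
  !![v1.1, v1.2.1, v1.2.2; v2.1, v2.2.1, v2.2.2; v3.1, v3.2.1, v3.2.2; v4.1, v4.2.1, v4.2.2;
     v5.1, v5.2.1, v5.2.2; v6.1, v6.2.1, v6.2.2; v7.1, v7.2.1, v7.2.2; v8.1, v8.2.1, v8.2.2]

theorem dt_comm (u v : V3) : dt u v = dt v u := by
  unfold dt; ring

theorem dt_neg_left (u v : V3) : dt (-u) v = - dt u v := by
  simp only [dt, Prod.fst_neg, Prod.snd_neg]; ring

theorem dt_neg_right (u v : V3) : dt u (-v) = - dt u v := by
  simp only [dt, Prod.fst_neg, Prod.snd_neg]; ring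

theorem gram_eq (v1 v2 v3 v4 v5 v6 v7 v8 : V3) :
    gramRows v1 v2 v3 v4 v5 v6 v7 v8 * (gramRows v1 v2 v3 v4 v5 v6 v7 v8)ᵀ =
    Matrix.of fun i j => dt (![v1, v2, v3, v4, v5, v6, v7, v8] i)
      (![v1, v2, v3, v4, v5, v6, v7, v8] j) := by
  have h : ∀ i, gramRows v1 v2 v3 v4 v5 v6 v7 v8 i =
      ![(![v1, v2, v3, v4, v5, v6, v7, v8] i).1, (![v1, v2, v3, v4, v5, v6, v7, v8] i).2.1,
        (![v1, v2, v3, v4, v5, v6, v7, v8] i).2.2] := by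
    intro i
    fin_cases i <;> rfl
  ext i j
  rw [Matrix.mul_apply, Fin.sum_univ_three]
  simp only [Matrix.transpose_apply, h, Matrix.of_apply, dt]
  rfl

theorem gram_packing (μ : ℝ) (v1 v2 v3 v4 v5 v6 v7 v8 : V3)
    (n1 : dt v1 v1 = 1) (n2 : dt v2 v2 = 1) (n3 : dt v3 v3 = 1) (n4 : dt v4 v4 = 1)
    (n5 : dt v5 v5 = 1) (n6 : dt v6 v6 = 1) (n7 : dt v7 v7 = 1) (n8 : dt v8 v8 = 1)
    (h13 : dt v1 v3 = μ) (h16 : dt v1 v6 = -μ) (h18 : dt v1 v8 = -μ) (h23 : dt v2 v3 = -μ)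
    (h25 : dt v2 v5 = -μ) (h27 : dt v2 v7 = -μ) (h34 : dt v3 v4 = μ) (h36 : dt v3 v6 = -μ)
    (h47 : dt v4 v7 = μ) (h48 : dt v4 v8 = μ) (h56 : dt v5 v6 = μ) (h57 : dt v5 v7 = μ)
    (h58 : dt v5 v8 = -μ) (h67 : dt v6 v7 = μ) :
    packingGram μ (dt v1 v2) (dt v1 v4) (dt v1 v5) (dt v1 v7) (dt v2 v4) (dt v2 v6) (dt v2 v8)
      (dt v3 v5) (dt v3 v7) (dt v3 v8) (dt v4 v5) (dt v4 v6) (dt v6 v8) (dt v7 v8)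
    = gramRows v1 v2 v3 v4 v5 v6 v7 v8 * (gramRows v1 v2 v3 v4 v5 v6 v7 v8)ᵀ := by
  rw [gram_eq]
  ext i j
  fin_cases i <;> fin_cases j <;>
    first
    | rfl
    | exact dt_comm _ _
    | exact Eq.symm (by assumption)
    | exact Eq.symm ((dt_comm _ _).trans (by assumption))

theorem gram_rank (v1 v2 v3 v4 v5 v6 v7 v8 : V3)
    (h : (!![v5.1, v5.2.1, v5.2.2; v6.1, v6.2.1, v6.2.2; v7.1, v7.2.1, v7.2.2]).det ≠ 0) :
    (gramRows v1 v2 v3 v4 v5 v6 v7 v8 * (gramRows v1 v2 v3 v4 v5 v6 v7 v8)ᵀ).rank = 3 := by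
  rw [Matrix.rank_self_mul_transpose]
  refine le_antisymm (Matrix.rank_le_width _) ?_
  have h1 := Matrix.rank_submatrix_le (gramRows v1 v2 v3 v4 v5 v6 v7 v8) ![4, 5, 6] id
  have h2 : (gramRows v1 v2 v3 v4 v5 v6 v7 v8).submatrix ![4, 5, 6] id
      = !![v5.1, v5.2.1, v5.2.2; v6.1, v6.2.1, v6.2.2; v7.1, v7.2.1, v7.2.2] := by
    ext i j
    fin_cases i <;> rfl
  rw [h2, Matrix.rank_of_isUnit _ ((Matrix.isUnit_iff_isUnit_det _).2 (isUnit_iff_ne_zero.2 h))]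
    at h1
  simpa using h1

/-! The configuration as a function of `m`. -/

def w5 (_ : ℝ) : V3 := (1, 0, 0)
def w7 (m : ℝ) : V3 := (m, Real.sqrt (1 - m ^ 2), 0)
def w6 (m : ℝ) : V3 := th m (w5 m) (w7 m)
def n2 (m : ℝ) : V3 := th m (w7 m) (w5 m)
def w3 (m : ℝ) : V3 := th m (n2 m) (-w6 m)
def w1 (m : ℝ) : V3 := th m (-w6 m) (w3 m)
def w4 (m : ℝ) : V3 := th m (w7 m) (w3 m)
def w8 (m : ℝ) : V3 := th m (-w1 m) (w4 m)

/-- All steps of the construction are nondegenerate. -/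
def AllGood (m : ℝ) : Prop :=
  Good m (w5 m) (w7 m) ∧ Good m (w7 m) (w5 m) ∧ Good m (n2 m) (-w6 m) ∧
  Good m (-w6 m) (w3 m) ∧ Good m (w7 m) (w3 m) ∧ Good m (-w1 m) (w4 m)

theorem w8_cont (S : Set ℝ) (h : ∀ m ∈ S, AllGood m) : ContinuousOn w8 S := by
  have c5 : ContinuousOn w5 S := by unfold w5; fun_prop
  have c7 : ContinuousOn w7 S := by unfold w7; fun_prop
  have c6 : ContinuousOn w6 S := th_cont S _ _ c5 c7 fun m hm => (h m hm).1
  have c2 : ContinuousOn n2 S := th_cont S _ _ c7 c5 fun m hm => (h m hm).2.1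
  have c3 : ContinuousOn w3 S := th_cont S n2 (fun m => -w6 m) c2 c6.neg fun m hm => (h m hm).2.2.1
  have c1 : ContinuousOn w1 S :=
    th_cont S (fun m => -w6 m) w3 c6.neg c3 fun m hm => (h m hm).2.2.2.1
  have c4 : ContinuousOn w4 S := th_cont S w7 w3 c7 c3 fun m hm => (h m hm).2.2.2.2.1
  exact th_cont S (fun m => -w1 m) w4 c1.neg c4 fun m hm => (h m hm).2.2.2.2.2

theorem w7_near {m m0 s0 e δ : ℝ} (hm : |m - m0| ≤ e) (m1 : 0 ≤ m0) (m2 : m0 ≤ 7 / 10)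
    (he : e ≤ 1 / 10000) (hδ : δ ≤ e) (hs : 1 / 2 ≤ s0) (h : |1 - m0 ^ 2 - s0 ^ 2| ≤ δ) :
    NV (w7 m) m0 s0 0 (1000 * e) := by
  have he0 : 0 ≤ e := (abs_nonneg _).trans hm
  refine ⟨?_, ?_, ?_⟩
  · simp only [w7]; linarith
  · simp only [w7]
    have hmm := abs_le.1 hm
    have h1 : 0 ≤ 1 - m ^ 2 := by nlinarith
    have h2 := Real.sq_sqrt h1
    have h3 := Real.sqrt_nonneg (1 - m ^ 2)
    have hh := abs_le.1 h
    generalize Real.sqrt (1 - m ^ 2) = s at *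
    rw [abs_le]
    have h4 : |(s - s0) * (s + s0)| ≤ 4 * e := by
      have : (s - s0) * (s + s0) = (1 - m0 ^ 2 - s0 ^ 2) - (m - m0) * (m + m0) := by
        nlinarith only [h2]
      rw [this]
      have h5 : |(m - m0) * (m + m0)| ≤ e * 2 := by
        rw [abs_mul]
        gcongr
        rw [abs_le]; constructor <;> linarith
      have h6 := abs_le.1 h5
      rw [abs_le]; constructor <;> linarith
    rw [abs_mul, abs_of_pos (show 0 < s + s0 by linarith)] at h4
    have h7 : |s - s0| ≤ 1000 * e := by nlinarith only [h4, abs_nonneg (s - s0), h3, hs, he0]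
    exact abs_le.1 h7
  · simp only [w7]; simpa using by linarith

theorem chain_left (m e : ℝ) (h1 : 1 / 10 ^ 40 ≤ e) (h2 : e ≤ 1 / 10 ^ 20)
    (hm : |m - 0.6475889787341786273366| ≤ e) :
    AllGood m ∧ (
NV (w1 m) 0.1602592056883902464596964335121583802701861082 (-0.4286346761022608323617243835360717791424419789) (-0.8891508878895843366435370698301785376030191179) (10 ^ 15 * e) ∧
    NV (n2 m) 0.6475889787341786273366 0.2995020165606689198445676335437987348575868319 (-0.7006618704468770660020709101701356190086875439) (10 ^ 15 * e) ∧
    NV (w3 m) (-0.1602592056883902464596964335121583802701861082) 0.3465155144405266061033939455589208199692927573 (-0.9242532040756707186823952356548231930959656942) (10 ^ 15 * e) ∧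
    NV (w4 m) (-0.1035908988460907539592347633321329584614081223) 0.9379039806280361708071340377694219285215006239 (-0.3310665322836836440734132745562853330538353077) (10 ^ 15 * e) ∧
    NV (w5 m) 1 0 0 (10 ^ 15 * e) ∧
    NV (w6 m) 0.6475889787341786273366 0.2995020165606689198445676335437987348575868319 0.7006618704468770660020709101701356190086875439 (10 ^ 15 * e) ∧
    NV (w7 m) 0.6475889787341786273366 0.7619898389230814025082832899379732352504908885 0 (10 ^ 15 * e) ∧
    NV (w8 m) (-0.6475889787341786273791669299836488317430098887) 0.7134254560833184324563440706852091176431278061 0.267680094953533338306870804984128102238333264 (10 ^ 15 * e)) := by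
  have k5 : NV (w5 m) 1 0 0 (1000 * e) := by
    refine ⟨?_, ?_, ?_⟩ <;> simp [w5] <;> linarith
  have k7 : NV (w7 m) 0.6475889787341786273366 0.7619898389230814025082832899379732352504908885 0 (1000 * e) :=
    w7_near hm (by norm_num) (by norm_num) (by linarith) h1 (by norm_num) (by norm_num [abs_le])
  have u1 : U3 0.1602592056883902464596964335121583802701861082 (-0.4286346761022608323617243835360717791424419789) (-0.8891508878895843366435370698301785376030191179) := by norm_num [U3, abs_le]
  have u2 : U3 0.6475889787341786273366 0.2995020165606689198445676335437987348575868319 (-0.7006618704468770660020709101701356190086875439) := by norm_num [U3, abs_le]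
  have u3 : U3 (-0.1602592056883902464596964335121583802701861082) 0.3465155144405266061033939455589208199692927573 (-0.9242532040756707186823952356548231930959656942) := by norm_num [U3, abs_le]
  have u4 : U3 (-0.1035908988460907539592347633321329584614081223) 0.9379039806280361708071340377694219285215006239 (-0.3310665322836836440734132745562853330538353077) := by norm_num [U3, abs_le]
  have u5 : U3 1 0 0 := by norm_num [U3, abs_le]
  have u6 : U3 0.6475889787341786273366 0.2995020165606689198445676335437987348575868319 0.7006618704468770660020709101701356190086875439 := by norm_num [U3, abs_le]
  have u7 : U3 0.6475889787341786273366 0.7619898389230814025082832899379732352504908885 0 := by norm_num [U3, abs_le]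
  have u8 : U3 (-0.6475889787341786273791669299836488317430098887) 0.7134254560833184324563440706852091176431278061 0.267680094953533338306870804984128102238333264 := by norm_num [U3, abs_le]
  have s6 := th_near (m0 := 0.6475889787341786273366) (c0 := 0.6475889787341786273366) (l0 := 0.3930525070832367981615739838517188612290164713)
    (g0 := 0.9195160285038983955345685130198218294620847471) (w1 := 0.6475889787341786273366)
    (w2 := 0.2995020165606689198445676335437987348575868319) (w3 := 0.7006618704468770660020709101701356190086875439)
    (e := (1000 * e)) (δ := 1 / 10 ^ 40) (m := m)
    (k5.mono (by linarith)) (k7.mono (by linarith)) (hm.trans (by linarith)) u5 u7 (by linarith) (by linarith)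
    (by norm_num) (by norm_num) (by norm_num) (by norm_num) (by norm_num) (by norm_num) (by norm_num) (by norm_num) (by norm_num) 
    (by norm_num [abs_le]) (by norm_num [abs_le]) (by norm_num [abs_le]) (by norm_num [abs_le]) (by norm_num [abs_le]) (by norm_num [abs_le]) 
  have k6 : NV (w6 m) 0.6475889787341786273366 0.2995020165606689198445676335437987348575868319 0.7006618704468770660020709101701356190086875439 (1000 * (1000 * e)) := s6.2
  have s2 := th_near (m0 := 0.6475889787341786273366) (c0 := 0.6475889787341786273366) (l0 := 0.3930525070832367981615739838517188612290164713)
    (g0 := 0.9195160285038983955345685130198218294620847471) (w1 := 0.6475889787341786273366)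
    (w2 := 0.2995020165606689198445676335437987348575868319) (w3 := (-0.7006618704468770660020709101701356190086875439))
    (e := (1000 * e)) (δ := 1 / 10 ^ 40) (m := m)
    (k7.mono (by linarith)) (k5.mono (by linarith)) (hm.trans (by linarith)) u7 u5 (by linarith) (by linarith)
    (by norm_num) (by norm_num) (by norm_num) (by norm_num) (by norm_num) (by norm_num) (by norm_num) (by norm_num) (by norm_num) 
    (by norm_num [abs_le]) (by norm_num [abs_le]) (by norm_num [abs_le]) (by norm_num [abs_le]) (by norm_num [abs_le]) (by norm_num [abs_le]) 
  have k2 : NV (n2 m) 0.6475889787341786273366 0.2995020165606689198445676335437987348575868319 (-0.7006618704468770660020709101701356190086875439) (1000 * (1000 * e)) := s2.2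
  have s3 := th_near (m0 := 0.6475889787341786273366) (c0 := (-0.0181458866037673167001040645931245550839341148)) (l0 := 0.6595572294280754278721125909406462000023399235)
    (g0 := 0.381842931208032400581817344731677263293714602) (w1 := (-0.1602592056883902464596964335121583802701861082))
    (w2 := 0.3465155144405266061033939455589208199692927573) (w3 := (-0.9242532040756707186823952356548231930959656942))
    (e := (1000 * (1000 * e))) (δ := 1 / 10 ^ 40) (m := m)
    (k2.mono (by linarith)) (k6.mono (by linarith)).neg (hm.trans (by linarith)) u2 u6.neg (by linarith) (by linarith)
    (by norm_num) (by norm_num) (by norm_num) (by norm_num) (by norm_num) (by norm_num) (by norm_num) (by norm_num) (by norm_num) 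
    (by norm_num [abs_le]) (by norm_num [abs_le]) (by norm_num [abs_le]) (by norm_num [abs_le]) (by norm_num [abs_le]) (by norm_num [abs_le]) 
  have k3 : NV (w3 m) (-0.1602592056883902464596964335121583802701861082) 0.3465155144405266061033939455589208199692927573 (-0.9242532040756707186823952356548231930959656942) (1000 * (1000 * (1000 * e))) := s3.2
  have s1 := th_near (m0 := 0.6475889787341786273366) (c0 := 0.6475889787341786273366) (l0 := 0.3930525070832367981615739838517188612290164713)
    (g0 := 0.9195160285038983955345685130198218294620847471) (w1 := 0.1602592056883902464596964335121583802701861082)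
    (w2 := (-0.4286346761022608323617243835360717791424419789)) (w3 := (-0.8891508878895843366435370698301785376030191179))
    (e := (1000 * (1000 * (1000 * e)))) (δ := 1 / 10 ^ 40) (m := m)
    (k6.mono (by linarith)).neg (k3.mono (by linarith)) (hm.trans (by linarith)) u6.neg u3 (by linarith) (by linarith)
    (by norm_num) (by norm_num) (by norm_num) (by norm_num) (by norm_num) (by norm_num) (by norm_num) (by norm_num) (by norm_num) 
    (by norm_num [abs_le]) (by norm_num [abs_le]) (by norm_num [abs_le]) (by norm_num [abs_le]) (by norm_num [abs_le]) (by norm_num [abs_le]) 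
  have k1 : NV (w1 m) 0.1602592056883902464596964335121583802701861082 (-0.4286346761022608323617243835360717791424419789) (-0.8891508878895843366435370698301785376030191179) (1000 * (1000 * (1000 * (1000 * e)))) := s1.2
  have s4 := th_near (m0 := 0.6475889787341786273366) (c0 := 0.1602592056883902464596964335121583802701861082) (l0 := 0.5581416424530407966286563355732929959659142043)
    (g0 := 0.5333027278157094872640889916815509709190449671) (w1 := (-0.1035908988460907539592347633321329584614081223))
    (w2 := 0.9379039806280361708071340377694219285215006239) (w3 := (-0.3310665322836836440734132745562853330538353077))
    (e := (1000 * (1000 * (1000 * e)))) (δ := 1 / 10 ^ 40) (m := m)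
    (k7.mono (by linarith)) (k3.mono (by linarith)) (hm.trans (by linarith)) u7 u3 (by linarith) (by linarith)
    (by norm_num) (by norm_num) (by norm_num) (by norm_num) (by norm_num) (by norm_num) (by norm_num) (by norm_num) (by norm_num) 
    (by norm_num [abs_le]) (by norm_num [abs_le]) (by norm_num [abs_le]) (by norm_num [abs_le]) (by norm_num [abs_le]) (by norm_num [abs_le]) 
  have k4 : NV (w4 m) (-0.1035908988460907539592347633321329584614081223) 0.9379039806280361708071340377694219285215006239 (-0.3310665322836836440734132745562853330538353077) (1000 * (1000 * (1000 * (1000 * e)))) := s4.2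
  have s8 := th_near (m0 := 0.6475889787341786273366) (c0 := 0.1242514629865772390378690494684810184957798337) (l0 := 0.5760179106317163654524109229829953294452713797)
    (g0 := 0.5078744249992327723912467416761441438065046142) (w1 := (-0.6475889787341786273791669299836488317430098887))
    (w2 := 0.7134254560833184324563440706852091176431278061) (w3 := 0.267680094953533338306870804984128102238333264)
    (e := (1000 * (1000 * (1000 * (1000 * e))))) (δ := 1 / 10 ^ 40) (m := m)
    (k1.mono (by linarith)).neg (k4.mono (by linarith)) (hm.trans (by linarith)) u1.neg u4 (by linarith) (by linarith)
    (by norm_num) (by norm_num) (by norm_num) (by norm_num) (by norm_num) (by norm_num) (by norm_num) (by norm_num) (by norm_num) 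
    (by norm_num [abs_le]) (by norm_num [abs_le]) (by norm_num [abs_le]) (by norm_num [abs_le]) (by norm_num [abs_le]) (by norm_num [abs_le]) 
  have k8 : NV (w8 m) (-0.6475889787341786273791669299836488317430098887) 0.7134254560833184324563440706852091176431278061 0.267680094953533338306870804984128102238333264 (1000 * (1000 * (1000 * (1000 * (1000 * e))))) := s8.2
  exact ⟨⟨s6.1, s2.1, s3.1, s1.1, s4.1, s8.1⟩,
    k1.mono (by linarith), k2.mono (by linarith), k3.mono (by linarith), k4.mono (by linarith), k5.mono (by linarith), k6.mono (by linarith), k7.mono (by linarith), k8.mono (by linarith)⟩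

theorem chain_right (m e : ℝ) (h1 : 1 / 10 ^ 40 ≤ e) (h2 : e ≤ 1 / 10 ^ 20)
    (hm : |m - 0.6475889787341786273466| ≤ e) :
    AllGood m ∧ (
NV (w1 m) 0.1602592056883902464308348900215032988923223287 (-0.4286346761022608324267597562505136495633715776) (-0.8891508878895843366173873035750065206366126684) (10 ^ 15 * e) ∧
    NV (n2 m) 0.6475889787341786273466 0.2995020165606689198440342735993294759257242762 (-0.7006618704468770659930563659586857169884373067) (10 ^ 15 * e) ∧
    NV (w3 m) (-0.1602592056883902464308348900215032988923223287) 0.3465155144405266060469569034465255858217432252 (-0.9242532040756707187085586707494466858163443343) (10 ^ 15 * e) ∧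
    NV (w4 m) (-0.1035908988460907539039219143987152505963905738) 0.9379039806280361707850692307619988545929845524 (-0.3310665322836836441532297932497533252316193952) (10 ^ 15 * e) ∧
    NV (w5 m) 1 0 0 (10 ^ 15 * e) ∧
    NV (w6 m) 0.6475889787341786273466 0.2995020165606689198440342735993294759257242762 0.7006618704468770659930563659586857169884373067 (10 ^ 15 * e) ∧
    NV (w7 m) 0.6475889787341786273466 0.7619898389230814024997846335825365966775763165 0 (10 ^ 15 * e) ∧
    NV (w8 m) (-0.6475889787341786273034280775219505257988418559) 0.7134254560833184325395377672096151716535868509 0.2676800949535333382683739015374950667798161564 (10 ^ 15 * e)) := by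
  have k5 : NV (w5 m) 1 0 0 (1000 * e) := by
    refine ⟨?_, ?_, ?_⟩ <;> simp [w5] <;> linarith
  have k7 : NV (w7 m) 0.6475889787341786273466 0.7619898389230814024997846335825365966775763165 0 (1000 * e) :=
    w7_near hm (by norm_num) (by norm_num) (by linarith) h1 (by norm_num) (by norm_num [abs_le])
  have u1 : U3 0.1602592056883902464308348900215032988923223287 (-0.4286346761022608324267597562505136495633715776) (-0.8891508878895843366173873035750065206366126684) := by norm_num [U3, abs_le]
  have u2 : U3 0.6475889787341786273466 0.2995020165606689198440342735993294759257242762 (-0.7006618704468770659930563659586857169884373067) := by norm_num [U3, abs_le]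
  have u3 : U3 (-0.1602592056883902464308348900215032988923223287) 0.3465155144405266060469569034465255858217432252 (-0.9242532040756707187085586707494466858163443343) := by norm_num [U3, abs_le]
  have u4 : U3 (-0.1035908988460907539039219143987152505963905738) 0.9379039806280361707850692307619988545929845524 (-0.3310665322836836441532297932497533252316193952) := by norm_num [U3, abs_le]
  have u5 : U3 1 0 0 := by norm_num [U3, abs_le]
  have u6 : U3 0.6475889787341786273466 0.2995020165606689198440342735993294759257242762 0.7006618704468770659930563659586857169884373067 := by norm_num [U3, abs_le]
  have u7 : U3 0.6475889787341786273466 0.7619898389230814024997846335825365966775763165 0 := by norm_num [U3, abs_le]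
  have u8 : U3 (-0.6475889787341786273034280775219505257988418559) 0.7134254560833184325395377672096151716535868509 0.2676800949535333382683739015374950667798161564 := by norm_num [U3, abs_le]
  have s6 := th_near (m0 := 0.6475889787341786273466) (c0 := 0.6475889787341786273466) (l0 := 0.3930525070832367981652578364432983043996731091)
    (g0 := 0.9195160285038983955329938286728819864443352532) (w1 := 0.6475889787341786273466)
    (w2 := 0.2995020165606689198440342735993294759257242762) (w3 := 0.7006618704468770659930563659586857169884373067)
    (e := (1000 * e)) (δ := 1 / 10 ^ 40) (m := m)
    (k5.mono (by linarith)) (k7.mono (by linarith)) (hm.trans (by linarith)) u5 u7 (by linarith) (by linarith)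
    (by norm_num) (by norm_num) (by norm_num) (by norm_num) (by norm_num) (by norm_num) (by norm_num) (by norm_num) (by norm_num) 
    (by norm_num [abs_le]) (by norm_num [abs_le]) (by norm_num [abs_le]) (by norm_num [abs_le]) (by norm_num [abs_le]) (by norm_num [abs_le]) 
  have k6 : NV (w6 m) 0.6475889787341786273466 0.2995020165606689198440342735993294759257242762 0.7006618704468770659930563659586857169884373067 (1000 * (1000 * e)) := s6.2
  have s2 := th_near (m0 := 0.6475889787341786273466) (c0 := 0.6475889787341786273466) (l0 := 0.3930525070832367981652578364432983043996731091)
    (g0 := 0.9195160285038983955329938286728819864443352532) (w1 := 0.6475889787341786273466)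
    (w2 := 0.2995020165606689198440342735993294759257242762) (w3 := (-0.7006618704468770659930563659586857169884373067))
    (e := (1000 * e)) (δ := 1 / 10 ^ 40) (m := m)
    (k7.mono (by linarith)) (k5.mono (by linarith)) (hm.trans (by linarith)) u7 u5 (by linarith) (by linarith)
    (by norm_num) (by norm_num) (by norm_num) (by norm_num) (by norm_num) (by norm_num) (by norm_num) (by norm_num) (by norm_num) 
    (by norm_num [abs_le]) (by norm_num [abs_le]) (by norm_num [abs_le]) (by norm_num [abs_le]) (by norm_num [abs_le]) (by norm_num [abs_le]) 
  have k2 : NV (n2 m) 0.6475889787341786273466 0.2995020165606689198440342735993294759257242762 (-0.7006618704468770659930563659586857169884373067) (1000 * (1000 * e)) := s2.2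
  have s3 := th_near (m0 := 0.6475889787341786273466) (c0 := (-0.0181458866037673167253686542268067824013075635)) (l0 := 0.6595572294280754278992688073048063453047909481)
    (g0 := 0.3818429312080324005186428399890048886223958638) (w1 := (-0.1602592056883902464308348900215032988923223287))
    (w2 := 0.3465155144405266060469569034465255858217432252) (w3 := (-0.9242532040756707187085586707494466858163443343))
    (e := (1000 * (1000 * e))) (δ := 1 / 10 ^ 40) (m := m)
    (k2.mono (by linarith)) (k6.mono (by linarith)).neg (hm.trans (by linarith)) u2 u6.neg (by linarith) (by linarith)
    (by norm_num) (by norm_num) (by norm_num) (by norm_num) (by norm_num) (by norm_num) (by norm_num) (by norm_num) (by norm_num) 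
    (by norm_num [abs_le]) (by norm_num [abs_le]) (by norm_num [abs_le]) (by norm_num [abs_le]) (by norm_num [abs_le]) (by norm_num [abs_le]) 
  have k3 : NV (w3 m) (-0.1602592056883902464308348900215032988923223287) 0.3465155144405266060469569034465255858217432252 (-0.9242532040756707187085586707494466858163443343) (1000 * (1000 * (1000 * e))) := s3.2
  have s1 := th_near (m0 := 0.6475889787341786273466) (c0 := 0.6475889787341786273466) (l0 := 0.3930525070832367981652578364432983043996731091)
    (g0 := 0.9195160285038983955329938286728819864443352532) (w1 := 0.1602592056883902464308348900215032988923223287)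
    (w2 := (-0.4286346761022608324267597562505136495633715776)) (w3 := (-0.8891508878895843366173873035750065206366126684))
    (e := (1000 * (1000 * (1000 * e)))) (δ := 1 / 10 ^ 40) (m := m)
    (k6.mono (by linarith)).neg (k3.mono (by linarith)) (hm.trans (by linarith)) u6.neg u3 (by linarith) (by linarith)
    (by norm_num) (by norm_num) (by norm_num) (by norm_num) (by norm_num) (by norm_num) (by norm_num) (by norm_num) (by norm_num) 
    (by norm_num [abs_le]) (by norm_num [abs_le]) (by norm_num [abs_le]) (by norm_num [abs_le]) (by norm_num [abs_le]) (by norm_num [abs_le]) 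
  have k1 : NV (w1 m) 0.1602592056883902464308348900215032988923223287 (-0.4286346761022608324267597562505136495633715776) (-0.8891508878895843366173873035750065206366126684) (1000 * (1000 * (1000 * (1000 * e)))) := s1.2
  have s4 := th_near (m0 := 0.6475889787341786273466) (c0 := 0.1602592056883902464308348900215032988923223287) (l0 := 0.5581416424530407966511589187543620370423666194)
    (g0 := 0.5333027278157094872227704868891029281483836154) (w1 := (-0.1035908988460907539039219143987152505963905738))
    (w2 := 0.9379039806280361707850692307619988545929845524) (w3 := (-0.3310665322836836441532297932497533252316193952))
    (e := (1000 * (1000 * (1000 * e)))) (δ := 1 / 10 ^ 40) (m := m)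
    (k7.mono (by linarith)) (k3.mono (by linarith)) (hm.trans (by linarith)) u7 u3 (by linarith) (by linarith)
    (by norm_num) (by norm_num) (by norm_num) (by norm_num) (by norm_num) (by norm_num) (by norm_num) (by norm_num) (by norm_num) 
    (by norm_num [abs_le]) (by norm_num [abs_le]) (by norm_num [abs_le]) (by norm_num [abs_le]) (by norm_num [abs_le]) (by norm_num [abs_le]) 
  have k4 : NV (w4 m) (-0.1035908988460907539039219143987152505963905738) 0.9379039806280361707850692307619988545929845524 (-0.3310665322836836441532297932497533252316193952) (1000 * (1000 * (1000 * (1000 * e)))) := s4.2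
  have s8 := th_near (m0 := 0.6475889787341786273466) (c0 := 0.1242514629865772390152424405169604057039746087) (l0 := 0.5760179106317163654728986277103235743677364823)
    (g0 := 0.5078744249992327723517434985067049105964133268) (w1 := (-0.6475889787341786273034280775219505257988418559))
    (w2 := 0.7134254560833184325395377672096151716535868509) (w3 := 0.2676800949535333382683739015374950667798161564)
    (e := (1000 * (1000 * (1000 * (1000 * e))))) (δ := 1 / 10 ^ 40) (m := m)
    (k1.mono (by linarith)).neg (k4.mono (by linarith)) (hm.trans (by linarith)) u1.neg u4 (by linarith) (by linarith)
    (by norm_num) (by norm_num) (by norm_num) (by norm_num) (by norm_num) (by norm_num) (by norm_num) (by norm_num) (by norm_num) 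
    (by norm_num [abs_le]) (by norm_num [abs_le]) (by norm_num [abs_le]) (by norm_num [abs_le]) (by norm_num [abs_le]) (by norm_num [abs_le]) 
  have k8 : NV (w8 m) (-0.6475889787341786273034280775219505257988418559) 0.7134254560833184325395377672096151716535868509 0.2676800949535333382683739015374950667798161564 (1000 * (1000 * (1000 * (1000 * (1000 * e))))) := s8.2
  exact ⟨⟨s6.1, s2.1, s3.1, s1.1, s4.1, s8.1⟩,
    k1.mono (by linarith), k2.mono (by linarith), k3.mono (by linarith), k4.mono (by linarith), k5.mono (by linarith), k6.mono (by linarith), k7.mono (by linarith), k8.mono (by linarith)⟩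

theorem dt_small {u v : V3} {a1 a2 a3 b1 b2 b3 e μ : ℝ}
    (hu : NV u a1 a2 a3 e) (hv : NV v b1 b2 b3 e) (ha : U3 a1 a2 a3) (hb : U3 b1 b2 b3)
    (he : e ≤ 1 / 10000) (hμ : 64 / 100 ≤ μ) (h : |a1 * b1 + a2 * b2 + a3 * b3| ≤ 6 / 10) :
    |dt u v| < μ := by
  have := abs_le_near (dt_near hu hv ha hb (by linarith)) h
  linarith

theorem exists_root : ∃ m : ℝ, 0.6475889787341786273366 ≤ m ∧ m ≤ 0.6475889787341786273466 ∧
    (w8 m).1 + m = 0 := by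
  have hgood : ∀ m ∈ Set.Icc (0.6475889787341786273366 : ℝ) 0.6475889787341786273466, AllGood m := by
    intro m hm
    refine (chain_left m (1 / 10 ^ 20) (by norm_num) le_rfl ?_).1
    rw [abs_le]
    constructor <;> linarith [hm.1, hm.2]
  have hc : ContinuousOn (fun m => (w8 m).1 + m) (Set.Icc (0.6475889787341786273366 : ℝ) 0.6475889787341786273466) := by
    exact (continuous_fst.comp_continuousOn (w8_cont _ hgood)).add continuousOn_id
  have hl := (chain_left 0.6475889787341786273366 (1 / 10 ^ 40) le_rfl (by norm_num)
    (by norm_num)).2.2.2.2.2.2.2.2.1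
  have hr := (chain_right 0.6475889787341786273466 (1 / 10 ^ 40) le_rfl (by norm_num)
    (by norm_num)).2.2.2.2.2.2.2.2.1
  rw [abs_le] at hl hr
  have h0 : (0 : ℝ) ∈ Set.Icc ((w8 0.6475889787341786273366).1 + 0.6475889787341786273366)
      ((w8 0.6475889787341786273466).1 + 0.6475889787341786273466) := by
    constructor
    · linarith [hl.2]
    · linarith [hr.1]
  obtain ⟨m, hm, h⟩ := intermediate_value_Icc (by norm_num) hc h0
  exact ⟨m, hm.1, hm.2, h⟩

theorem norms_and_contacts (m : ℝ) (hm : m ^ 2 ≤ 1) (h : AllGood m) :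
    (dt (w1 m) (w1 m) = 1 ∧ dt (n2 m) (n2 m) = 1 ∧ dt (w3 m) (w3 m) = 1 ∧ dt (w4 m) (w4 m) = 1 ∧
      dt (w5 m) (w5 m) = 1 ∧ dt (w6 m) (w6 m) = 1 ∧ dt (w7 m) (w7 m) = 1 ∧
      dt (w8 m) (w8 m) = 1) ∧
    dt (w1 m) (w3 m) = m ∧ dt (w1 m) (w6 m) = -m ∧ dt (w8 m) (w1 m) = -m ∧
    dt (w3 m) (n2 m) = m ∧ dt (n2 m) (w5 m) = m ∧ dt (n2 m) (w7 m) = m ∧ dt (w4 m) (w3 m) = m ∧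
    dt (w3 m) (w6 m) = -m ∧ dt (w4 m) (w7 m) = m ∧ dt (w8 m) (w4 m) = m ∧
    dt (w6 m) (w5 m) = m ∧ dt (w5 m) (w7 m) = m ∧ dt (w6 m) (w7 m) = m := by
  obtain ⟨g6, g2, g3, g1, g4, g8⟩ := h
  have n5 : dt (w5 m) (w5 m) = 1 := by simp [dt, w5]
  have n7 : dt (w7 m) (w7 m) = 1 := by
    simp only [dt, w7]
    rw [Real.mul_self_sqrt (by linarith)]; ring
  have h57 : dt (w5 m) (w7 m) = m := by simp [dt, w5, w7]
  obtain ⟨n6, h65, h67⟩ : dt (w6 m) (w6 m) = 1 ∧ dt (w6 m) (w5 m) = m ∧ dt (w6 m) (w7 m) = m :=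
    th_spec m _ _ n5 n7 g6
  obtain ⟨n2', h27, h25⟩ : dt (n2 m) (n2 m) = 1 ∧ dt (n2 m) (w7 m) = m ∧ dt (n2 m) (w5 m) = m :=
    th_spec m _ _ n7 n5 g2
  have n6' : dt (-w6 m) (-w6 m) = 1 := by rw [dt_neg_left, dt_neg_right, n6]; ring
  obtain ⟨n3, h32, h36⟩ : dt (w3 m) (w3 m) = 1 ∧ dt (w3 m) (n2 m) = m ∧ dt (w3 m) (-w6 m) = m :=
    th_spec m _ _ n2' n6' g3
  obtain ⟨n1, h16, h13⟩ : dt (w1 m) (w1 m) = 1 ∧ dt (w1 m) (-w6 m) = m ∧ dt (w1 m) (w3 m) = m :=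
    th_spec m _ _ n6' n3 g1
  obtain ⟨n4, h47, h43⟩ : dt (w4 m) (w4 m) = 1 ∧ dt (w4 m) (w7 m) = m ∧ dt (w4 m) (w3 m) = m :=
    th_spec m _ _ n7 n3 g4
  have n1' : dt (-w1 m) (-w1 m) = 1 := by rw [dt_neg_left, dt_neg_right, n1]; ring
  obtain ⟨n8, h81, h84⟩ : dt (w8 m) (w8 m) = 1 ∧ dt (w8 m) (-w1 m) = m ∧ dt (w8 m) (w4 m) = m :=
    th_spec m _ _ n1' n4 g8
  rw [dt_neg_right] at h36 h16 h81
  exact ⟨⟨n1, n2', n3, n4, n5, n6, n7, n8⟩, h13, by linarith, by linarith, h32, h25, h27, h43,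
    by linarith, h47, h84, h65, h57, h67⟩

end


/-- **Existence part of the main theorem.** There exist reals `μ, a₁, …, a₁₄` such that
`G(μ, a₁, …, a₁₄)` has rank 3, is positive semidefinite, `0.6 ≤ μ ≤ 0.64759`, and
`|aⱼ| < μ` for all `j`. -/
theorem main_existence :
    ∃ μ a1 a2 a3 a4 a5 a6 a7 a8 a9 a10 a11 a12 a13 a14 : ℝ,
      (packingGram μ a1 a2 a3 a4 a5 a6 a7 a8 a9 a10 a11 a12 a13 a14).rank = 3 ∧
      (packingGram μ a1 a2 a3 a4 a5 a6 a7 a8 a9 a10 a11 a12 a13 a14).PosSemidef ∧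
      (0.6 : ℝ) ≤ μ ∧ μ ≤ 0.64759 ∧
      |a1| < μ ∧ |a2| < μ ∧ |a3| < μ ∧ |a4| < μ ∧ |a5| < μ ∧ |a6| < μ ∧ |a7| < μ ∧
      |a8| < μ ∧ |a9| < μ ∧ |a10| < μ ∧ |a11| < μ ∧ |a12| < μ ∧ |a13| < μ ∧ |a14| < μ := by
  obtain ⟨m, hm1, hm2, hroot⟩ := exists_root
  obtain ⟨hgood, k1, k2, k3, k4, k5, k6, k7, k8⟩ :=
    chain_left m (1 / 10 ^ 20) (by norm_num) le_rfl
      (by rw [abs_le]; constructor <;> linarith)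
  obtain ⟨⟨n1, n2', n3, n4, n5, n6, n7, n8⟩, h13, h16, h81, h32, h25, h27, h43, h36, h47, h84,
    h65, h57, h67⟩ := norms_and_contacts m (by nlinarith) hgood
  have h58 : dt (w5 m) (w8 m) = -m := by
    simp only [dt, w5]; linarith
  have hG := gram_packing m (w1 m) (-n2 m) (w3 m) (w4 m) (w5 m) (w6 m) (w7 m) (w8 m)
    n1 (by rw [dt_neg_left, dt_neg_right, n2', neg_neg]) n3 n4 n5 n6 n7 n8
    h13 h16 (by rw [dt_comm, h81]) (by rw [dt_neg_left, dt_comm, h32])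
    (by rw [dt_neg_left, h25]) (by rw [dt_neg_left, h27]) (by rw [dt_comm, h43]) h36 h47
    (by rw [dt_comm, h84]) (by rw [dt_comm, h65]) h57 h58 h67
  have hdet : (!![(w5 m).1, (w5 m).2.1, (w5 m).2.2; (w6 m).1, (w6 m).2.1, (w6 m).2.2;
      (w7 m).1, (w7 m).2.1, (w7 m).2.2]).det ≠ 0 := by
    have q6 : 0 < (w6 m).2.2 := by
      have := (abs_le.1 k6.2.2).1
      linarith
    have q7 : 0 < (w7 m).2.1 := by
      have := (abs_le.1 k7.2.1).1
      linarith
    have : (!![(w5 m).1, (w5 m).2.1, (w5 m).2.2; (w6 m).1, (w6 m).2.1, (w6 m).2.2;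
      (w7 m).1, (w7 m).2.1, (w7 m).2.2]).det = -((w6 m).2.2 * (w7 m).2.1) := by
      rw [Matrix.det_fin_three]
      simp [w5, w7]
    rw [this]
    exact neg_ne_zero.2 (mul_pos q6 q7).ne'
  refine ⟨m, dt (w1 m) (-n2 m), dt (w1 m) (w4 m), dt (w1 m) (w5 m), dt (w1 m) (w7 m),
    dt (-n2 m) (w4 m), dt (-n2 m) (w6 m), dt (-n2 m) (w8 m), dt (w3 m) (w5 m),
    dt (w3 m) (w7 m), dt (w3 m) (w8 m), dt (w4 m) (w5 m), dt (w4 m) (w6 m), dt (w6 m) (w8 m), dt (w7 m) (w8 m),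
    ?_, ?_, ?_, ?_, ?_⟩
  rotate_left 4
  · have hμ : 64 / 100 ≤ m := by linarith
    have he : (10 : ℝ) ^ 15 * (1 / 10 ^ 20) ≤ 1 / 10000 := by norm_num
    have k2' := k2.neg
    refine ⟨dt_small k1 k2' ?_ ?_ he hμ ?_, dt_small k1 k4 ?_ ?_ he hμ ?_,
      dt_small k1 k5 ?_ ?_ he hμ ?_, dt_small k1 k7 ?_ ?_ he hμ ?_,
      dt_small k2' k4 ?_ ?_ he hμ ?_, dt_small k2' k6 ?_ ?_ he hμ ?_,
      dt_small k2' k8 ?_ ?_ he hμ ?_, dt_small k3 k5 ?_ ?_ he hμ ?_,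
      dt_small k3 k7 ?_ ?_ he hμ ?_, dt_small k3 k8 ?_ ?_ he hμ ?_,
      dt_small k4 k5 ?_ ?_ he hμ ?_, dt_small k4 k6 ?_ ?_ he hμ ?_,
      dt_small k6 k8 ?_ ?_ he hμ ?_, dt_small k7 k8 ?_ ?_ he hμ ?_⟩ <;>
    norm_num [U3, abs_le]
  · rw [hG]
    exact gram_rank _ _ _ _ _ _ _ _ hdet
  · rw [hG, ← Matrix.conjTranspose_eq_transpose_of_trivial]
    exact Matrix.posSemidef_self_mul_conjTranspose _
  · linarith
  · linarith
end

section
/- Suppose real numbers μ, a_1, …, a_14 and μ', a'_1, …, a'_14 both satisfy: the 8 × 8 symmetric matrix G(μ, a_1, …, a_14) (respectively G(μ', a'_1, …, a'_14)) has rank 3, is positive semidefinite, 0.6 ≤ μ ≤ 0.64759 (resp. for μ'), and |a_j| < μ (resp. |a'_j| < μ') for all 1 ≤ j ≤ 14. Then μ = μ' and a_j = a'_j for all 1 ≤ j ≤ 14. -/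
theorem minor_det_zero {M : Matrix (Fin 8) (Fin 8) ℝ} (hr : M.rank = 3)
    (f g : Fin 4 → Fin 8) : (M.submatrix f g).det = 0 := by
  by_contra h
  have h1 : (M.submatrix f g).rank = 4 := by
    rw [Matrix.rank_of_isUnit _ ((Matrix.isUnit_iff_isUnit_det _).2 (isUnit_iff_ne_zero.2 h))]
    simp
  have h2 : (M.submatrix f g).rank ≤ M.rank := Matrix.rank_submatrix_le M f g
  omega

theorem det_bordered (μ x1 x2 x3 y1 y2 y3 g : ℝ) :
    (!![1, μ, μ, y1; μ, 1, μ, y2; μ, μ, 1, y3; x1, x2, x3, g] : Matrix (Fin 4) (Fin 4) ℝ).det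
      = (1 - μ) * ((1 - μ) * (1 + 2 * μ) * g - ((1 + 2 * μ) * (x1 * y1 + x2 * y2 + x3 * y3)
          - μ * (x1 + x2 + x3) * (y1 + y2 + y3))) := by
  simp [Matrix.det_succ_row_zero, Fin.sum_univ_succ, Fin.succAbove]
  ring

/-- In a rank-3 matrix with vectors 5, 6, 7 forming an equiangular basis, every entry is
determined by the coordinates with respect to that basis. -/
theorem gram_relation {M : Matrix (Fin 8) (Fin 8) ℝ} (hr : M.rank = 3) (μ : ℝ) (hμ : μ < 1)
    (h44 : M 4 4 = 1) (h45 : M 4 5 = μ) (h46 : M 4 6 = μ) (h54 : M 5 4 = μ) (h55 : M 5 5 = 1)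
    (h56 : M 5 6 = μ) (h64 : M 6 4 = μ) (h65 : M 6 5 = μ) (h66 : M 6 6 = 1) (i j : Fin 8) :
    (1 + 2 * μ) * (M i 4 * M 4 j + M i 5 * M 5 j + M i 6 * M 6 j)
      - μ * (M i 4 + M i 5 + M i 6) * (M 4 j + M 5 j + M 6 j)
      = (1 - μ) * (1 + 2 * μ) * M i j := by
  have h := minor_det_zero hr ![4, 5, 6, i] ![4, 5, 6, j]
  have e : M.submatrix ![4, 5, 6, i] ![4, 5, 6, j] =
      !![1, μ, μ, M 4 j; μ, 1, μ, M 5 j; μ, μ, 1, M 6 j; M i 4, M i 5, M i 6, M i j] := by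
    ext a b
    fin_cases a <;> fin_cases b <;> simp [*]
  rw [e, det_bordered] at h
  rcases mul_eq_zero.1 h with h | h
  · linarith
  · linarith

/-- The minimal polynomial of the optimal coherence is injective on `[0.6, ∞)`. -/
theorem coherence_poly_injective {x y : ℝ} (hx : (0.6 : ℝ) ≤ x) (hy : (0.6 : ℝ) ≤ y)
    (px : 1 + 5*x - 8*x^2 - 80*x^3 - 78*x^4 + 146*x^5 - 80*x^6 - 584*x^7 + 677*x^8 + 1537*x^9 = 0)
    (py : 1 + 5*y - 8*y^2 - 80*y^3 - 78*y^4 + 146*y^5 - 80*y^6 - 584*y^7 + 677*y^8 + 1537*y^9 = 0) :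
    x = y := by
  have key : ∀ s r : ℝ, 0 ≤ s → s < r →
      (35982848/390625)*s + (103051904/78125)*s^2 + (97429312/15625)*s^3 + (52230816/3125)*s^4
        + (17956592/625)*s^5 + (4022336/125)*s^6 + (564628/25)*s^7 + (44884/5)*s^8 + 1537*s^9 <
      (35982848/390625)*r + (103051904/78125)*r^2 + (97429312/15625)*r^3 + (52230816/3125)*r^4
        + (17956592/625)*r^5 + (4022336/125)*r^6 + (564628/25)*r^7 + (44884/5)*r^8 + 1537*r^9 := by
    intro s r hs hsr
    gcongr
  norm_num at hx hy
  rcases lt_trichotomy x y with h | h | h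
  · have := key (x - 3/5) (y - 3/5) (by linarith) (by linarith)
    ring_nf at this px py
    linarith
  · exact h
  · have := key (y - 3/5) (x - 3/5) (by linarith) (by linarith)
    ring_nf at this px py
    linarith

/-- Bounds on the cubic that governs `a₈`. -/
theorem cubic_lower_s4 {μ : ℝ} (hμ1 : (0.6 : ℝ) ≤ μ) (hμ2 : μ ≤ 0.64759) :
    (0.117 : ℝ) ≤ 1 + μ - 3*μ^2 - μ^3 := by
  norm_num at hμ1 hμ2 ⊢
  nlinarith [mul_nonneg (sub_nonneg.2 hμ1) (sub_nonneg.2 hμ2),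
    mul_nonneg (mul_nonneg (sub_nonneg.2 hμ1) (sub_nonneg.2 hμ2)) (by linarith : 0 ≤ μ)]

set_option maxHeartbeats 1000000 in
/-- Solving the contact equations in the coordinates given by vectors 5, 6, 7. -/
theorem contact_solve (μ a3 a4 a5 a6 a8 a9 a11 a12 a13 a14 : ℝ)
    (hμ1 : (0.6 : ℝ) ≤ μ) (hμ2 : μ ≤ 0.64759)
    (h3 : |a3| < μ) (h5 : |a5| < μ) (h6 : |a6| < μ) (h11 : |a11| < μ)
    (e22 : (1 + 2*μ) * (2*μ^2 + a6^2) - μ * (a6 - 2*μ)^2 = (1 - μ) * (1 + 2*μ))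
    (e23 : (1 + 2*μ) * (-μ*a8 - μ*a6 - μ*a9) - μ * (a6 - 2*μ) * (a8 + a9 - μ)
      = -((1 - μ) * (1 + 2*μ) * μ))
    (e33 : (1 + 2*μ) * (a8^2 + μ^2 + a9^2) - μ * (a8 + a9 - μ)^2 = (1 - μ) * (1 + 2*μ))
    (e34 : (1 + 2*μ) * (a8*a11 - μ*a12 + a9*μ) - μ * (a8 + a9 - μ) * (a11 + a12 + μ)
      = (1 - μ) * (1 + 2*μ) * μ)
    (e44 : (1 + 2*μ) * (a11^2 + a12^2 + μ^2) - μ * (a11 + a12 + μ)^2 = (1 - μ) * (1 + 2*μ))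
    (e24 : (1 + 2*μ) * (-μ*a11 + a6*a12 - μ^2) - μ * (a6 - 2*μ) * (a11 + a12 + μ)
      = (1 - μ) * (1 + 2*μ) * a5)
    (e13 : (1 + 2*μ) * (a3*a8 + μ^2 + a4*a9) - μ * (a3 - μ + a4) * (a8 + a9 - μ)
      = (1 - μ) * (1 + 2*μ) * μ)
    (e11 : (1 + 2*μ) * (a3^2 + μ^2 + a4^2) - μ * (a3 - μ + a4)^2 = (1 - μ) * (1 + 2*μ))
    (e18 : (1 + 2*μ) * (-μ*a3 - μ*a13 + a4*a14) - μ * (a3 - μ + a4) * (-μ + a13 + a14)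
      = -((1 - μ) * (1 + 2*μ) * μ))
    (e48 : (1 + 2*μ) * (-μ*a11 + a12*a13 + μ*a14) - μ * (a11 + a12 + μ) * (-μ + a13 + a14)
      = (1 - μ) * (1 + 2*μ) * μ)
    (e88 : (1 + 2*μ) * (μ^2 + a13^2 + a14^2) - μ * (-μ + a13 + a14)^2
      = (1 - μ) * (1 + 2*μ)) :
    (1 + 5*μ - 8*μ^2 - 80*μ^3 - 78*μ^4 + 146*μ^5 - 80*μ^6 - 584*μ^7 + 677*μ^8 + 1537*μ^9 = 0) ∧
    a8 < 0 ∧ 2 * (1 + 2*μ) * a8^2 = 1 + μ - 3*μ^2 - μ^3 ∧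
    (1 + μ) * a6 = 1 + μ - 4*μ^2 ∧ a9 = -a8 ∧ a12 = a6 ∧
    (1 + μ)^2 * a11 = μ * (1 + μ)^2 + 4*μ*((1 + 2*μ)*a8 - μ^2) ∧ a3 = -a8 ∧
    (1 + μ) * a4 = -(1 + 3*μ)*a8 - 2*μ^2 ∧
    0 < (1 + 3*μ) * (μ^2*(1 + 3*μ) - (1 - μ)*((1 + 2*μ)*a8)) ∧
    (1 + 3*μ) * (μ^2*(1 + 3*μ) - (1 - μ)*((1 + 2*μ)*a8)) * a13 =
      μ * (-2*μ - 9*μ^2 + 19*μ^4 - (1 + 2*μ + 5*μ^2)*((1 + 2*μ)*a8)) ∧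
    (1 + 3*μ) * (μ^2*(1 + 3*μ) - (1 - μ)*((1 + 2*μ)*a8)) * a14 =
      μ * (-1 - 2*μ + 5*μ^2 + 8*μ^3 - 2*μ^4 - (1 + 2*μ - 11*μ^2)*((1 + 2*μ)*a8)) := by
  have hC := cubic_lower_s4 hμ1 hμ2
  norm_num at hμ1 hμ2 hC
  have hm : 0 < μ := by linarith
  have ho : 0 < 1 + μ := by linarith
  have hK : 0 < 1 + 2*μ := by linarith
  have hi : 0 < 1 - μ := by linarith
  rw [abs_lt] at h3 h5 h6 h11
  -- vector 2
  have k6 : (1 + μ) * a6 = 1 + μ - 4*μ^2 := by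
    have : (a6 + 1) * ((1 + μ) * a6 - (1 + μ - 4*μ^2)) = 0 := by linear_combination e22
    rcases mul_eq_zero.1 this with h | h <;> linarith
  -- vector 3
  have k9 : a9 = -a8 := by
    have : μ * (1 + a6) * (a8 + a9) = 0 := by linear_combination -e23 - μ * k6
    have h' : μ * (1 + a6) ≠ 0 := mul_ne_zero hm.ne' (by linarith)
    have := (mul_eq_zero.1 this).resolve_left h'
    linarith
  subst k9
  have k8 : 2 * (1 + 2*μ) * a8^2 = 1 + μ - 3*μ^2 - μ^3 := by linear_combination e33
  obtain ⟨T, hT⟩ : ∃ T, T = (1 + 2*μ) * a8 := ⟨_, rfl⟩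
  have hT2 : T^2 = (1 + 2*μ) * (1 + μ - 3*μ^2 - μ^3) / 2 := by
    rw [hT]; linear_combination (1 + 2*μ) / 2 * k8
  have hTb : 0.35^2 ≤ T^2 := by
    have := mul_le_mul (by linarith : (2.2 : ℝ) ≤ 1 + 2*μ) hC (by norm_num) hK.le
    rw [hT2]; norm_num at this ⊢; linarith
  -- vector 4
  have hlin : (T + μ^2) * (a11 - μ) - μ * (1 + μ) * (a12 + a6) = 0 := by
    rw [hT]; linear_combination e34 - μ * k6
  have k11 : (1 + μ)^2 * (a11 - μ) = 4*μ*(T - μ^2) := by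
    have hquad : (1 + 2*μ) * (2*μ*(a11 - μ) + (a11 - μ)^2 + (a12 + a6)^2 - 2*a6*(a12 + a6))
        - μ * (((a11 - μ) + (a12 + a6))^2 + 2*((a11 - μ) + (a12 + a6))*(2*μ - a6)) = 0 := by
      linear_combination e44 - e22
    have hu : a11 - μ ≠ 0 := by linarith
    generalize a11 - μ = u at *
    generalize a12 + a6 = v at *
    obtain ⟨w, rfl⟩ : ∃ w, u = μ * (1 + μ) * w := ⟨u / (μ * (1 + μ)), by field_simp⟩
    have hv : v = (T + μ^2) * w := by
      have : μ * (1 + μ) * (v - (T + μ^2) * w) = 0 := by linear_combination -hlin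
      have := (mul_eq_zero.1 this).resolve_left (by positivity)
      linarith
    subst hv
    have hw : w ≠ 0 := right_ne_zero_of_mul hu
    have h1 : (2*((1 + 2*μ)*μ*(μ*(1 + μ)) - 2*μ^2*(μ*(1 + μ) + (T + μ^2)))
          + 2*a6*(μ*(μ*(1 + μ)) - (1 + μ)*(T + μ^2)))
        + w * ((1 + μ)*((μ*(1 + μ))^2 + (T + μ^2)^2) - 2*μ*(μ*(1 + μ))*(T + μ^2)) = 0 := by
      apply mul_left_cancel₀ hw
      linear_combination hquad
    have hQ : 0 < (1 + μ)*((μ*(1 + μ))^2 + (T + μ^2)^2) - 2*μ*(μ*(1 + μ))*(T + μ^2) := by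
      have : 0 < (μ*(1 + μ))^2 := by positivity
      nlinarith [mul_nonneg hm.le (sq_nonneg (μ*(1 + μ) - (T + μ^2))), sq_nonneg (T + μ^2)]
    apply mul_left_cancel₀ (mul_pos ho hQ).ne'
    linear_combination (μ * (1 + μ)^4) * h1
      - 2 * (μ*(μ*(1 + μ)) - (1 + μ)*(T + μ^2)) * μ * (1 + μ)^3 * k6
      - ((-4*μ^3 - 8*μ^4 - 4*μ^5) + (4*μ + 8*μ^2 + 4*μ^3)*T) * hT2
  have k12 : a12 = a6 := by
    have : μ * (1 + μ)^3 * (a12 + a6) = μ * (1 + μ)^3 * (2 * a6) := by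
      linear_combination -(1 + μ)^2 * hlin + (T + μ^2) * k11 + 4 * μ * hT2
        - 2 * μ * (1 + μ)^2 * k6
    have := mul_left_cancel₀ (by positivity) this
    linarith
  subst k12
  have k5 : (1 + μ)^3 * (a5 + 1) = 2*(1 + μ - 4*μ^2)*(1 + μ)^2 - 8*μ^2*(T - μ^2) := by
    have h0 : (1 - μ) * (1 + 2*μ) * (a5 + 1) =
        -μ * (1 + a12) * (a11 - μ) + 2 * a12 * ((1 + μ) * a12 + 2*μ^2) := by
      linear_combination -e24 - e22
    have h1 : (1 + μ) * (a5 + 1) = -2*μ*(a11 - μ) + 2*(1 + μ - 4*μ^2) := by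
      apply mul_left_cancel₀ (mul_pos hi hK).ne'
      linear_combination (1 + μ) * h0 +
        (-μ * (a11 - μ) + 2*((1 + μ)*a12 + (1 + μ - 4*μ^2) + 2*μ^2)) * k6
    linear_combination (1 + μ)^2 * h1 - 2 * μ * k11
  -- sign of `a8`
  have hneg : T ≤ -0.35 := by
    rcases le_or_gt T 0 with h | h
    · by_contra h'
      norm_num at h' hTb
      nlinarith only [h, h', hTb]
    · exfalso
      have hT35 : 0.35 ≤ T := by
        by_contra h'
        norm_num at h' hTb
        nlinarith only [h, h', hTb]
      have b1 : 0.36 ≤ μ^2 := by nlinarith only [hμ1]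
      have b2 : μ^2 ≤ 0.42 := by nlinarith only [hμ1, hμ2]
      have b3 : 4.09 ≤ (1 + μ)^3 := by
        calc (4.09 : ℝ) ≤ (1 + 3/5)^3 := by norm_num
          _ ≤ (1 + μ)^3 := by gcongr
      have b4 : (1 + μ)^2 ≤ 2.72 := by nlinarith only [hμ1, hμ2]
      have b5 : 1 + μ - 4*μ^2 ≤ 0.16 := by nlinarith only [hμ1, hμ2]
      have b6 : (1 + μ - 4*μ^2)*(1 + μ)^2 ≤ 0.16 * 2.72 := by
        calc (1 + μ - 4*μ^2)*(1 + μ)^2 ≤ 0.16 * (1 + μ)^2 := by gcongr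
          _ ≤ 0.16 * 2.72 := by gcongr
      have b7 : (1 + μ)^3 * (1 - μ) ≥ 4.09 * 0.352 := by
        have : (0.352 : ℝ) ≤ 1 - μ := by norm_num; linarith
        gcongr
      have b8 : -(0.42 * 0.07) ≤ μ^2*(T - μ^2) := by
        nlinarith only [b1, b2, hT35]
      have b9 : (1 + μ)^3 * (1 - μ) < (1 + μ)^3 * (a5 + 1) := by
        apply mul_lt_mul_of_pos_left _ (by positivity)
        linarith
      norm_num at b6 b7 b8
      linarith
  have k8n : a8 < 0 := by
    by_contra h
    have : 0 ≤ (1 + 2*μ) * a8 := mul_nonneg hK.le (not_lt.1 h)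
    linarith
  -- vector 1
  have hD : T * (a3 - a4) = μ * (1 - 3*μ^2) - μ^2 * (a3 + a4) := by
    rw [hT]; linear_combination e13
  have hS : ((1 + μ) * (a3 + a4) + 2*μ^2)^2 = (2*T)^2 := by
    have h0 : (a3 + a4)^2 + (1 + 2*μ)*(a3 - a4)^2 - 2*(1 + μ - 3*μ^2 - μ^3)
        + 4*μ^2*(a3 + a4) = 0 := by
      linear_combination 2 * e11
    have h1 : (1 + μ - 3*μ^2 - μ^3) * ((a3 + a4)^2 + 4*μ^2*(a3 + a4))
        - 2*(1 + μ - 3*μ^2 - μ^3)^2 + 2*(μ * (1 - 3*μ^2) - μ^2 * (a3 + a4))^2 = 0 := by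
      linear_combination (1 + μ - 3*μ^2 - μ^3) * h0
        - 2 * (T * (a3 - a4) + (μ * (1 - 3*μ^2) - μ^2 * (a3 + a4))) * hD
        + 2 * (a3 - a4)^2 * hT2
    apply mul_left_cancel₀ (mul_pos (pow_pos hi 2) hK).ne'
    linear_combination (1 + μ) * h1 - 4 * (1 - μ)^2 * (1 + 2*μ) * hT2
  have hT0 : T ≠ 0 := by
    intro h
    rw [h] at hneg
    norm_num at hneg
  have k34 : a3 = -a8 ∧ (1 + μ) * a4 = -(1 + 3*μ)*a8 - 2*μ^2 := by
    rcases sq_eq_sq_iff_eq_or_eq_neg.1 hS with hs | hs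
    · exfalso
      have hd : (1 + 2*μ) * (1 + μ) * (a3 - a4) = 2*μ*T - 2*μ^2*(1 + 2*μ) := by
        apply mul_left_cancel₀ hT0
        linear_combination (1 + 2*μ) * (1 + μ) * hD - (1 + 2*μ) * μ^2 * hs - 2 * μ * hT2
      have hd' : (1 + μ) * (a3 - a4) = 2*μ*a8 - 2*μ^2 := by
        apply mul_left_cancel₀ hK.ne'
        linear_combination hd + 2 * μ * hT
      have h3' : (1 + μ) * a3 = (1 + 3*μ)*a8 - 2*μ^2 := by
        linear_combination (hs + hd') / 2 + hT
      have b1 : a8 ≤ -0.15 := by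
        by_contra h'
        norm_num at h' hneg
        nlinarith only [h', hT, hneg, hμ1, hμ2]
      have b2 : (1 + μ) * (-μ) < (1 + μ) * a3 := mul_lt_mul_of_pos_left h3.1 ho
      norm_num at b1
      nlinarith only [b1, b2, h3', hμ1, hμ2]
    · have hd : (1 + 2*μ) * (1 + μ) * (a3 - a4) = 2*μ*T + 2*μ^2*(1 + 2*μ) := by
        apply mul_left_cancel₀ hT0
        linear_combination (1 + 2*μ) * (1 + μ) * hD - (1 + 2*μ) * μ^2 * hs - 2 * μ * hT2
      have hd' : (1 + μ) * (a3 - a4) = 2*μ*a8 + 2*μ^2 := by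
        apply mul_left_cancel₀ hK.ne'
        linear_combination hd + 2 * μ * hT
      have h3' : a3 = -a8 := by
        apply mul_left_cancel₀ ho.ne'
        linear_combination (hs + hd') / 2 - hT
      refine ⟨h3', ?_⟩
      linear_combination (hs - hd') / 2 - hT
  obtain ⟨k3, k4⟩ := k34
  subst k3
  -- vector 8
  have f18 : ((-1*μ - 4*μ^2 - 3*μ^3 + 2*μ^4) + (2*μ + 4*μ^2)*T) * a13
      + ((-1*μ^2 - 3*μ^3 - 2*μ^4) + (-1 - 3*μ - 2*μ^2)*T) * a14
      = (-1*μ - 4*μ^2 - 2*μ^3 + 9*μ^4 + 10*μ^5) + (-1*μ - 1*μ^2 + 2*μ^3)*T := by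
    rw [hT]
    linear_combination (1 + 2*μ) * (1 + μ) * e18
      - (1 + 2*μ) * ((1 + 2*μ) * a14 - μ * (-μ + a13 + a14)) * k4
  have f48 : ((1 + 3*μ - 3*μ^2 - 11*μ^3 - 2*μ^4) + (-4*μ^2)*T) * a13
      + ((4*μ^3 + 8*μ^4) + (-4*μ^2)*T) * a14
      = (1*μ + 3*μ^2 + 1*μ^3 - 3*μ^4 - 2*μ^5) + (4*μ^2 + 4*μ^3)*T := by
    linear_combination (1 + μ)^2 * e48
      - (-μ * (1 + 2*μ) - μ * (-μ + a13 + a14)) * k11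
      - (1 + μ) * ((1 + 2*μ) * a13 - μ * (-μ + a13 + a14)) * k6
  have hct : (1 + μ) * (1 + 2*μ)^2 * (μ - 1) ≠ 0 :=
    mul_ne_zero (by positivity) (by linarith)
  have k13 : (1 + 3*μ) * (μ^2*(1 + 3*μ) - (1 - μ)*T) * a13 =
      μ * (-2*μ - 9*μ^2 + 19*μ^4 - (1 + 2*μ + 5*μ^2)*T) := by
    apply mul_left_cancel₀ hct
    linear_combination ((4*μ^3 + 8*μ^4) + (-4*μ^2)*T) * f18
      - ((-1*μ^2 - 3*μ^3 - 2*μ^4) + (-1 - 3*μ - 2*μ^2)*T) * f48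
      - (-4*μ^2 - 20*μ^3 - 24*μ^4) * a13 * hT2 + (4*μ^2 + 20*μ^3 + 24*μ^4) * hT2
  have k14 : (1 + 3*μ) * (μ^2*(1 + 3*μ) - (1 - μ)*T) * a14 =
      μ * (-1 - 2*μ + 5*μ^2 + 8*μ^3 - 2*μ^4 - (1 + 2*μ - 11*μ^2)*T) := by
    apply mul_left_cancel₀ hct
    linear_combination -((1 + 3*μ - 3*μ^2 - 11*μ^3 - 2*μ^4) + (-4*μ^2)*T) * f18
      + ((-1*μ - 4*μ^2 - 3*μ^3 + 2*μ^4) + (2*μ + 4*μ^2)*T) * f48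
      - (-4*μ^2 - 20*μ^3 - 24*μ^4) * a14 * hT2 + (4*μ^3 + 20*μ^4 + 24*μ^5) * hT2
  have kΔ : 0 < (1 + 3*μ) * (μ^2*(1 + 3*μ) - (1 - μ)*T) := by
    have : 0 < (1 - μ) * (-T) := mul_pos hi (by linarith)
    have h2 : 0 < μ^2*(1 + 3*μ) := by positivity
    exact mul_pos (by linarith) (by linarith)
  have hG : (1 + 2*μ) * (μ^2*((1 + 3*μ) * (μ^2*(1 + 3*μ) - (1 - μ)*T))^2
        + ((1 + 3*μ) * (μ^2*(1 + 3*μ) - (1 - μ)*T) * a13)^2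
        + ((1 + 3*μ) * (μ^2*(1 + 3*μ) - (1 - μ)*T) * a14)^2)
      - μ * ((1 + 3*μ) * (μ^2*(1 + 3*μ) - (1 - μ)*T) * a13
        + (1 + 3*μ) * (μ^2*(1 + 3*μ) - (1 - μ)*T) * a14
        - μ * ((1 + 3*μ) * (μ^2*(1 + 3*μ) - (1 - μ)*T)))^2
      - (1 - μ) * (1 + 2*μ) * ((1 + 3*μ) * (μ^2*(1 + 3*μ) - (1 - μ)*T))^2 = 0 := by
    linear_combination ((1 + 3*μ) * (μ^2*(1 + 3*μ) - (1 - μ)*T))^2 * e88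
  rw [k13, k14] at hG
  have hfin : 1 + 3*μ - 6*μ^2 - 26*μ^3 - 3*μ^4 + 31*μ^5 = 8*μ^2*(1 + 3*μ)*T := by
    have hc : (μ - 1) * (1 + 2*μ) * (17*μ^4 - 4*μ^3 - 2*μ^2 + 4*μ + 1) ≠ 0 := by
      have : 0 < 17*μ^4 - 4*μ^3 - 2*μ^2 + 4*μ + 1 := by
        have c1 : 0 < μ * ((1 - μ) * (1 + μ)) := mul_pos hm (mul_pos hi ho)
        have c2 : μ^2 ≤ 0.42 := by nlinarith only [hμ1, hμ2]
        have c3 : 0 < μ^4 := by positivity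
        norm_num at c2
        linarith only [c1, c2, c3]
      exact mul_ne_zero (mul_ne_zero (by linarith) hK.ne') this.ne'
    apply mul_left_cancel₀ hc
    linear_combination 2 * hG
      - 2 * (-1 - 5*μ + 3*μ^2 + 39*μ^3 + 13*μ^4 - 79*μ^5 + 113*μ^6 + 301*μ^7) * hT2
  have hp : 1 + 5*μ - 8*μ^2 - 80*μ^3 - 78*μ^4 + 146*μ^5 - 80*μ^6 - 584*μ^7 + 677*μ^8
      + 1537*μ^9 = 0 := by
    apply mul_left_cancel₀ ho.ne'
    linear_combination (1 + 3*μ - 6*μ^2 - 26*μ^3 - 3*μ^4 + 31*μ^5 + 8*μ^2*(1 + 3*μ)*T) * hfin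
      + 64*μ^4*(1 + 3*μ)^2 * hT2
  rw [← hT]
  exact ⟨hp, k8n, k8, k6, rfl, rfl, by linear_combination k11, rfl, k4, kΔ, k13, k14⟩

/-- The relations used from the Gram matrix, in explicit form. -/
theorem packing_relations (μ a1 a2 a3 a4 a5 a6 a7 a8 a9 a10 a11 a12 a13 a14 : ℝ)
    (hrank : (packingGram μ a1 a2 a3 a4 a5 a6 a7 a8 a9 a10 a11 a12 a13 a14).rank = 3)
    (hμ : μ < 1) :
    (1 + 2 * μ) * ((-μ) * (-μ) + a6 * a6 + (-μ) * (-μ)) - μ * ((-μ) + a6 + (-μ)) * ((-μ) + a6 + (-μ)) = (1 - μ) * (1 + 2 * μ) * 1 ∧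
    (1 + 2 * μ) * ((-μ) * a8 + a6 * (-μ) + (-μ) * a9) - μ * ((-μ) + a6 + (-μ)) * (a8 + (-μ) + a9) = (1 - μ) * (1 + 2 * μ) * (-μ) ∧
    (1 + 2 * μ) * (a8 * a8 + (-μ) * (-μ) + a9 * a9) - μ * (a8 + (-μ) + a9) * (a8 + (-μ) + a9) = (1 - μ) * (1 + 2 * μ) * 1 ∧
    (1 + 2 * μ) * (a8 * a11 + (-μ) * a12 + a9 * μ) - μ * (a8 + (-μ) + a9) * (a11 + a12 + μ) = (1 - μ) * (1 + 2 * μ) * μ ∧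
    (1 + 2 * μ) * (a11 * a11 + a12 * a12 + μ * μ) - μ * (a11 + a12 + μ) * (a11 + a12 + μ) = (1 - μ) * (1 + 2 * μ) * 1 ∧
    (1 + 2 * μ) * ((-μ) * a11 + a6 * a12 + (-μ) * μ) - μ * ((-μ) + a6 + (-μ)) * (a11 + a12 + μ) = (1 - μ) * (1 + 2 * μ) * a5 ∧
    (1 + 2 * μ) * (a3 * a8 + (-μ) * (-μ) + a4 * a9) - μ * (a3 + (-μ) + a4) * (a8 + (-μ) + a9) = (1 - μ) * (1 + 2 * μ) * μ ∧
    (1 + 2 * μ) * (a3 * a3 + (-μ) * (-μ) + a4 * a4) - μ * (a3 + (-μ) + a4) * (a3 + (-μ) + a4) = (1 - μ) * (1 + 2 * μ) * 1 ∧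
    (1 + 2 * μ) * (a3 * (-μ) + (-μ) * a13 + a4 * a14) - μ * (a3 + (-μ) + a4) * ((-μ) + a13 + a14) = (1 - μ) * (1 + 2 * μ) * (-μ) ∧
    (1 + 2 * μ) * (a11 * (-μ) + a12 * a13 + μ * a14) - μ * (a11 + a12 + μ) * ((-μ) + a13 + a14) = (1 - μ) * (1 + 2 * μ) * μ ∧
    (1 + 2 * μ) * ((-μ) * (-μ) + a13 * a13 + a14 * a14) - μ * ((-μ) + a13 + a14) * ((-μ) + a13 + a14) = (1 - μ) * (1 + 2 * μ) * 1 ∧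
    (1 + 2 * μ) * (a3 * (-μ) + (-μ) * a6 + a4 * (-μ)) - μ * (a3 + (-μ) + a4) * ((-μ) + a6 + (-μ)) = (1 - μ) * (1 + 2 * μ) * a1 ∧
    (1 + 2 * μ) * (a3 * a11 + (-μ) * a12 + a4 * μ) - μ * (a3 + (-μ) + a4) * (a11 + a12 + μ) = (1 - μ) * (1 + 2 * μ) * a2 ∧
    (1 + 2 * μ) * ((-μ) * (-μ) + a6 * a13 + (-μ) * a14) - μ * ((-μ) + a6 + (-μ)) * ((-μ) + a13 + a14) = (1 - μ) * (1 + 2 * μ) * a7 ∧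
    (1 + 2 * μ) * (a8 * (-μ) + (-μ) * a13 + a9 * a14) - μ * (a8 + (-μ) + a9) * ((-μ) + a13 + a14) = (1 - μ) * (1 + 2 * μ) * a10 := by
  have key := gram_relation hrank μ hμ rfl rfl rfl rfl rfl rfl rfl rfl rfl
  exact ⟨key 1 1, key 1 2, key 2 2, key 2 3, key 3 3, key 1 3, key 0 2, key 0 0, key 0 7, key 3 7, key 7 7, key 0 1, key 0 3, key 1 7, key 2 7⟩

/-- **Uniqueness part of the main theorem.** Two tuples of reals satisfying the rank-3,
positive semidefinite, and coherence conditions for `G` must coincide. -/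
theorem main_uniqueness
    (μ a1 a2 a3 a4 a5 a6 a7 a8 a9 a10 a11 a12 a13 a14 : ℝ)
    (μ' b1 b2 b3 b4 b5 b6 b7 b8 b9 b10 b11 b12 b13 b14 : ℝ)
    (hrank : (packingGram μ a1 a2 a3 a4 a5 a6 a7 a8 a9 a10 a11 a12 a13 a14).rank = 3)
    (hpsd : (packingGram μ a1 a2 a3 a4 a5 a6 a7 a8 a9 a10 a11 a12 a13 a14).PosSemidef)
    (hμ1 : (0.6 : ℝ) ≤ μ) (hμ2 : μ ≤ 0.64759)
    (h1 : |a1| < μ) (h2 : |a2| < μ) (h3 : |a3| < μ) (h4 : |a4| < μ) (h5 : |a5| < μ)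
    (h6 : |a6| < μ) (h7 : |a7| < μ) (h8 : |a8| < μ) (h9 : |a9| < μ) (h10 : |a10| < μ)
    (h11 : |a11| < μ) (h12 : |a12| < μ) (h13 : |a13| < μ) (h14 : |a14| < μ)
    (hrank' : (packingGram μ' b1 b2 b3 b4 b5 b6 b7 b8 b9 b10 b11 b12 b13 b14).rank = 3)
    (hpsd' : (packingGram μ' b1 b2 b3 b4 b5 b6 b7 b8 b9 b10 b11 b12 b13 b14).PosSemidef)
    (hμ1' : (0.6 : ℝ) ≤ μ') (hμ2' : μ' ≤ 0.64759)
    (h1' : |b1| < μ') (h2' : |b2| < μ') (h3' : |b3| < μ') (h4' : |b4| < μ') (h5' : |b5| < μ')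
    (h6' : |b6| < μ') (h7' : |b7| < μ') (h8' : |b8| < μ') (h9' : |b9| < μ') (h10' : |b10| < μ')
    (h11' : |b11| < μ') (h12' : |b12| < μ') (h13' : |b13| < μ') (h14' : |b14| < μ') :
    μ = μ' ∧ a1 = b1 ∧ a2 = b2 ∧ a3 = b3 ∧ a4 = b4 ∧ a5 = b5 ∧ a6 = b6 ∧ a7 = b7 ∧
      a8 = b8 ∧ a9 = b9 ∧ a10 = b10 ∧ a11 = b11 ∧ a12 = b12 ∧ a13 = b13 ∧ a14 = b14 := by
  obtain ⟨e22x, e23x, e33x, e34x, e44x, e24x, e13x, e11x, e18x, e48x, e88x, e12x, e14x, e28x, e38x⟩ :=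
    packing_relations μ a1 a2 a3 a4 a5 a6 a7 a8 a9 a10 a11 a12 a13 a14
      hrank (by norm_num at hμ2; linarith)
  obtain ⟨px, k8nx, k8x, k6x, k9x, k12x, k11x, k3x, k4x, kdx, k13x, k14x⟩ :=
    contact_solve μ a3 a4 a5 a6 a8 a9 a11 a12 a13 a14 hμ1 hμ2
      h3 h5 h6 h11
      (by linear_combination e22x)
      (by linear_combination e23x)
      (by linear_combination e33x)
      (by linear_combination e34x)
      (by linear_combination e44x)
      (by linear_combination e24x)
      (by linear_combination e13x)
      (by linear_combination e11x)
      (by linear_combination e18x)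
      (by linear_combination e48x)
      (by linear_combination e88x)
  obtain ⟨e22y, e23y, e33y, e34y, e44y, e24y, e13y, e11y, e18y, e48y, e88y, e12y, e14y, e28y, e38y⟩ :=
    packing_relations μ' b1 b2 b3 b4 b5 b6 b7 b8 b9 b10 b11 b12 b13 b14
      hrank' (by norm_num at hμ2'; linarith)
  obtain ⟨py, k8ny, k8y, k6y, k9y, k12y, k11y, k3y, k4y, kdy, k13y, k14y⟩ :=
    contact_solve μ' b3 b4 b5 b6 b8 b9 b11 b12 b13 b14 hμ1' hμ2'
      h3' h5' h6' h11'
      (by linear_combination e22y)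
      (by linear_combination e23y)
      (by linear_combination e33y)
      (by linear_combination e34y)
      (by linear_combination e44y)
      (by linear_combination e24y)
      (by linear_combination e13y)
      (by linear_combination e11y)
      (by linear_combination e18y)
      (by linear_combination e48y)
      (by linear_combination e88y)
  obtain rfl : μ = μ' := coherence_poly_injective hμ1 hμ1' px py
  norm_num at hμ1 hμ2
  have ho : 0 < 1 + μ := by linarith
  have hK : 0 < 1 + 2 * μ := by linarith
  have hi : 0 < 1 - μ := by linarith
  obtain rfl : a8 = b8 := by
    have h1 : 2 * (1 + 2 * μ) * (a8 ^ 2 - b8 ^ 2) = 0 := by linear_combination k8x - k8y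
    have h2 := (mul_eq_zero.1 h1).resolve_left (by positivity)
    have h3 : (a8 + b8) * (a8 - b8) = 0 := by linear_combination h2
    have h4 := (mul_eq_zero.1 h3).resolve_left (by linarith)
    linarith
  obtain rfl : a6 = b6 := mul_left_cancel₀ ho.ne' (k6x.trans k6y.symm)
  obtain rfl : a9 = b9 := k9x.trans k9y.symm
  obtain rfl : a12 = b12 := k12x.trans k12y.symm
  obtain rfl : a11 = b11 := mul_left_cancel₀ (pow_pos ho 2).ne' (k11x.trans k11y.symm)
  obtain rfl : a3 = b3 := k3x.trans k3y.symm
  obtain rfl : a4 = b4 := mul_left_cancel₀ ho.ne' (k4x.trans k4y.symm)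
  obtain rfl : a13 = b13 := mul_left_cancel₀ kdx.ne' (k13x.trans k13y.symm)
  obtain rfl : a14 = b14 := mul_left_cancel₀ kdx.ne' (k14x.trans k14y.symm)
  have hg := (mul_pos hi hK).ne'
  exact ⟨rfl, mul_left_cancel₀ hg (e12x.symm.trans e12y), mul_left_cancel₀ hg (e14x.symm.trans e14y),
    rfl, rfl, mul_left_cancel₀ hg (e24x.symm.trans e24y), rfl,
    mul_left_cancel₀ hg (e28x.symm.trans e28y), rfl, rfl,
    mul_left_cancel₀ hg (e38x.symm.trans e38y), rfl, rfl, rfl, rfl⟩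
end

section
/- Suppose real numbers μ, a_1, …, a_14 are such that the 8 × 8 symmetric matrix G(μ, a_1, …, a_14) has rank at most 3, 0.6 ≤ μ ≤ 0.64759, and |a_j| < μ for all 1 ≤ j ≤ 14. Then 1 + 5μ − 8μ² − 80μ³ − 78μ⁴ + 146μ⁵ − 80μ⁶ − 584μ⁷ + 677μ⁸ + 1537μ⁹ = 0. -/
/-- All `4 × 4` minors of a matrix of rank at most three vanish. -/
lemma minor_eq_zero (M : Matrix (Fin 8) (Fin 8) ℝ) (h : M.rank ≤ 3) (f g : Fin 4 → Fin 8) :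
    (M.submatrix f g).det = 0 := by
  by_contra hd
  have h1 : (M.submatrix f g).rank = 4 := by
    have := Matrix.rank_of_isUnit (M.submatrix f g)
      ((Matrix.isUnit_iff_isUnit_det _).2 (isUnit_iff_ne_zero.2 hd))
    simpa using this
  have h2 : (M.submatrix f g).rank ≤ M.rank := Matrix.rank_submatrix_le M f g
  omega

/-- The vanishing bordered determinant expresses the Gram entry through the coordinates. -/
lemma bordered (μ x1 x2 x3 y1 y2 y3 z : ℝ) (hμ : 1 - μ ≠ 0)
    (h : (!![1, μ, μ, y1; μ, 1, μ, y2; μ, μ, 1, y3; x1, x2, x3, z] :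
      Matrix (Fin 4) (Fin 4) ℝ).det = 0) :
    (1 - μ) * (1 + 2 * μ) * z = (1 + 2 * μ) * (x1 * y1 + x2 * y2 + x3 * y3)
      - μ * (x1 + x2 + x3) * (y1 + y2 + y3) := by
  have h' : (1 - μ) * ((1 - μ) * (1 + 2 * μ) * z - ((1 + 2 * μ) * (x1 * y1 + x2 * y2 + x3 * y3)
      - μ * (x1 + x2 + x3) * (y1 + y2 + y3))) = 0 := by
    rw [← h]
    simp [Matrix.det_succ_row_zero, Fin.sum_univ_succ, Fin.succAbove]
    ring
  have := (mul_eq_zero.1 h').resolve_left hμ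
  linarith

/-- The vector `v₂`. -/
lemma step_a6 (μ a6 : ℝ) (h1 : -1 < a6)
    (N2 : (1 - μ) * (1 + 2 * μ) * 1 = (1 + 2 * μ) * (-μ * -μ + a6 * a6 + -μ * -μ)
      - μ * (-μ + a6 + -μ) * (-μ + a6 + -μ)) :
    (1 + μ) * a6 = 1 + μ - 4 * μ ^ 2 := by
  have : (a6 + 1) * ((1 + μ) * a6 - (1 + μ - 4 * μ ^ 2)) = 0 := by linear_combination -N2
  have := (mul_eq_zero.1 this).resolve_left (by linarith)
  linarith

/-- The vector `v₃`. -/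
lemma step_a8 (μ a6 a8 a9 : ℝ) (hμ : 0 < μ) (h1 : -1 < a6)
    (h6 : (1 + μ) * a6 = 1 + μ - 4 * μ ^ 2)
    (E : (1 - μ) * (1 + 2 * μ) * -μ = (1 + 2 * μ) * (-μ * a8 + a6 * -μ + -μ * a9)
      - μ * (-μ + a6 + -μ) * (a8 + -μ + a9)) : a8 = -a9 := by
  have : (μ * (1 + a6)) * (a8 + a9) = 0 := by linear_combination E - μ * h6
  have := (mul_eq_zero.1 this).resolve_left (by nlinarith)
  linarith

lemma step_T (μ t : ℝ)
    (N3 : (1 - μ) * (1 + 2 * μ) * 1 = (1 + 2 * μ) * (-t * -t + -μ * -μ + t * t)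
      - μ * (-t + -μ + t) * (-t + -μ + t)) :
    ((1 + 2 * μ) * t) ^ 2 = (1 + 2 * μ) * (1 + μ - 3 * μ ^ 2 - μ ^ 3) / 2 := by
  linear_combination -(1 + 2 * μ) / 2 * N3

/-- The vector `v₄`. -/
lemma step_a11 (μ t T a6 a11 a12 : ℝ) (hμ1 : 0 < μ) (hμ2 : μ < 1) (ha : a11 ≠ μ)
    (ht : T = (1 + 2 * μ) * t)
    (hT : T ^ 2 = (1 + 2 * μ) * (1 + μ - 3 * μ ^ 2 - μ ^ 3) / 2)
    (h6 : (1 + μ) * a6 = 1 + μ - 4 * μ ^ 2)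
    (E : (1 - μ) * (1 + 2 * μ) * μ = (1 + 2 * μ) * (-t * a11 + -μ * a12 + t * μ)
      - μ * (-t + -μ + t) * (a11 + a12 + μ))
    (N4 : (1 - μ) * (1 + 2 * μ) * 1 = (1 + 2 * μ) * (a11 * a11 + a12 * a12 + μ * μ)
      - μ * (a11 + a12 + μ) * (a11 + a12 + μ)) :
    (1 + μ) ^ 2 * a11 = μ + 2 * μ ^ 2 - 3 * μ ^ 3 - 4 * μ * T ∧
      (1 + μ) * a12 = 1 + μ - 4 * μ ^ 2 := by
  obtain ⟨u, hu⟩ : ∃ u, u = a11 - μ := ⟨_, rfl⟩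
  obtain ⟨w, hw⟩ : ∃ w, w = a12 + a6 := ⟨_, rfl⟩
  have hu0 : u ≠ 0 := by rw [hu]; exact sub_ne_zero.2 ha
  obtain rfl : a11 = u + μ := by linarith
  obtain rfl : a12 = w - a6 := by linarith
  have hl : μ * (1 + μ) * w = u * (μ ^ 2 - T) := by
    rw [ht]; linear_combination E + μ * h6
  have hq : (1 + μ) * (u ^ 2 + w ^ 2) - 2 * μ * u * w + 2 * μ * (1 + a6) * u
      - 2 * w * (1 + μ - 2 * μ ^ 2) = 0 := by
    linear_combination -N4 + (2 * w - a6 - 1) * h6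
  have hk : 0 < (1 - μ) * (1 + 2 * μ) := mul_pos (by linarith) (by linarith)
  have hc : (u * (1 + μ) * ((1 - μ) * (1 + 2 * μ))) *
      (u * (1 + μ) ^ 2 + 4 * μ * (μ ^ 2 + T)) = 0 := by
    linear_combination 2 * μ ^ 2 * (1 + μ) ^ 2 * hq
      - 2 * ((1 + μ) * (μ * (1 + μ) * w + u * (μ ^ 2 - T)) - 2 * μ ^ 2 * (1 + μ) * u
        - 2 * μ * (1 + μ) * (1 + μ - 2 * μ ^ 2)) * hl
      - 4 * μ ^ 3 * (1 + μ) * u * h6 - 2 * (1 + μ) * u ^ 2 * hT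
  have hne : u * (1 + μ) * ((1 - μ) * (1 + 2 * μ)) ≠ 0 :=
    mul_ne_zero (mul_ne_zero hu0 (by linarith)) hk.ne'
  have h11 := (mul_eq_zero.1 hc).resolve_left hne
  refine ⟨by linear_combination h11, ?_⟩
  have hz : (μ * (1 + μ) ^ 2) * ((1 + μ) * (w - a6) - (1 + μ - 4 * μ ^ 2)) = 0 := by
    linear_combination (1 + μ) ^ 2 * hl + (μ ^ 2 - T) * h11 + 4 * μ * hT - μ * (1 + μ) ^ 2 * h6
  have := (mul_eq_zero.1 hz).resolve_left (by positivity)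
  linarith

/-- The inner product of `v₂` and `v₄` decides the sign of `T`. -/
lemma step_sign (μ T a5 a6 a11 a12 : ℝ) (hμ1 : 0.6 ≤ μ) (hμ2 : μ ≤ 0.64759) (h5 : -μ < a5)
    (hT : T ^ 2 = (1 + 2 * μ) * (1 + μ - 3 * μ ^ 2 - μ ^ 3) / 2)
    (h6 : (1 + μ) * a6 = 1 + μ - 4 * μ ^ 2)
    (h11 : (1 + μ) ^ 2 * a11 = μ + 2 * μ ^ 2 - 3 * μ ^ 3 - 4 * μ * T)
    (h12 : (1 + μ) * a12 = 1 + μ - 4 * μ ^ 2)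
    (E : (1 - μ) * (1 + 2 * μ) * a5 = (1 + 2 * μ) * (-μ * a11 + a6 * a12 + -μ * μ)
      - μ * (-μ + a6 + -μ) * (a11 + a12 + μ)) : 0.36 < T := by
  have hk : 0 < (1 - μ) * (1 + 2 * μ) := mul_pos (by linarith) (by linarith)
  have e6 : a6 = (1 + μ - 4 * μ ^ 2) / (1 + μ) := by
    rw [eq_div_iff (by linarith)]; linarith
  have e12 : a12 = (1 + μ - 4 * μ ^ 2) / (1 + μ) := by
    rw [eq_div_iff (by linarith)]; linarith
  have e11 : a11 = (μ + 2 * μ ^ 2 - 3 * μ ^ 3 - 4 * μ * T) / (1 + μ) ^ 2 := by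
    rw [eq_div_iff (by positivity)]; linarith
  have e5 : (1 + μ) ^ 3 * a5 = 1 + 3 * μ - 5 * μ ^ 2 - 15 * μ ^ 3 + 8 * μ ^ 2 * T := by
    apply mul_left_cancel₀ hk.ne'
    have : (1 - μ) * (1 + 2 * μ) * ((1 + μ) ^ 3 * a5)
      = (1 + μ) ^ 3 * ((1 - μ) * (1 + 2 * μ) * a5) := by ring
    rw [this, E, e6, e12, e11]
    have : 1 + μ ≠ 0 := by linarith
    field_simp
    ring
  have h3 : -μ * (1 + μ) ^ 3 < 1 + 3 * μ - 5 * μ ^ 2 - 15 * μ ^ 3 + 8 * μ ^ 2 * T := by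
    rw [← e5]
    have : 0 < (1 + μ) ^ 3 := by positivity
    nlinarith
  have hm2 : 0.36 ≤ μ ^ 2 := by nlinarith
  have hm2' : μ ^ 2 ≤ 0.41938 := by nlinarith
  have hm3 : μ ^ 3 ≤ 0.27159 := by nlinarith
  have hlow : -0.1 < T := by
    by_contra hcon
    have : 8 * μ ^ 2 * T ≤ 8 * μ ^ 2 * (-0.1) := by
      apply mul_le_mul_of_nonneg_left (by linarith) (by positivity)
    nlinarith [mul_nonneg (sub_nonneg.2 hμ1) (sub_nonneg.2 hμ2)]
  have hT2 : 0.1297 < T ^ 2 := by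
    rw [hT]
    nlinarith
  by_contra hcon
  nlinarith

/-- The vector `v₁`. -/
lemma step_a3 (μ t T a3 a4 : ℝ) (hμ1 : 0.6 ≤ μ) (hμ2 : μ ≤ 0.64759) (h3 : -μ < a3)
    (ht : T = (1 + 2 * μ) * t) (hTpos : 0.36 < T)
    (hT : T ^ 2 = (1 + 2 * μ) * (1 + μ - 3 * μ ^ 2 - μ ^ 3) / 2)
    (E : (1 - μ) * (1 + 2 * μ) * μ = (1 + 2 * μ) * (a3 * -t + -μ * -μ + a4 * t)
      - μ * (a3 + -μ + a4) * (-t + -μ + t))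
    (N1 : (1 - μ) * (1 + 2 * μ) * 1 = (1 + 2 * μ) * (a3 * a3 + -μ * -μ + a4 * a4)
      - μ * (a3 + -μ + a4) * (a3 + -μ + a4)) :
    (1 + 2 * μ) * a3 = T ∧
      (1 + 2 * μ) * (1 + μ) * a4 = -2 * μ ^ 2 * (1 + 2 * μ) + (1 + 3 * μ) * T := by
  obtain ⟨p, hp⟩ : ∃ p, p = a3 + a4 := ⟨_, rfl⟩
  obtain ⟨q, hq⟩ : ∃ q, q = a4 - a3 := ⟨_, rfl⟩
  obtain rfl : a3 = (p - q) / 2 := by linarith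
  obtain rfl : a4 = (p + q) / 2 := by linarith
  have hL : T * q = -(μ ^ 2 * p + 3 * μ ^ 3 - μ) := by rw [ht]; linear_combination -E
  have hQ : p ^ 2 + (1 + 2 * μ) * q ^ 2 + 4 * μ ^ 2 * p
      + 2 * (3 * μ ^ 2 + μ ^ 3 - 1 - μ) = 0 := by linear_combination -2 * N1
  have hf : ((1 - μ) ^ 2 * (1 + 2 * μ) ^ 2) *
      ((((1 + μ) * p + 2 * μ ^ 2) - 2 * T) * (((1 + μ) * p + 2 * μ ^ 2) + 2 * T)) = 0 := by
    linear_combination 2 * (1 + μ) * T ^ 2 * hQ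
      - 2 * (1 + μ) * (1 + 2 * μ) * (T * q - (μ ^ 2 * p + 3 * μ ^ 3 - μ)) * hL
      - (2 * (1 + μ) * (p ^ 2 + 4 * μ ^ 2 * p + 2 * (3 * μ ^ 2 + μ ^ 3 - 1 - μ))
        + 4 * (1 - μ) ^ 2 * (1 + 2 * μ) ^ 2) * hT
  have hne : (1 - μ) ^ 2 * (1 + 2 * μ) ^ 2 ≠ 0 := by
    apply mul_ne_zero <;> apply pow_ne_zero <;> linarith
  have hTne : T ≠ 0 := by linarith
  rcases mul_eq_zero.1 ((mul_eq_zero.1 hf).resolve_left hne) with hA | hB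
  · have hq2 : (1 + 2 * μ) * (1 + μ) * q = -2 * μ ^ 2 * (1 + 2 * μ) + 2 * μ * T := by
      apply mul_left_cancel₀ hTne
      linear_combination (1 + 2 * μ) * (1 + μ) * hL - μ ^ 2 * (1 + 2 * μ) * hA - 2 * μ * hT
    have h1 : (1 + μ) ≠ 0 := by linarith
    constructor
    · apply mul_left_cancel₀ h1
      linear_combination (1 + 2 * μ) / 2 * hA - hq2 / 2
    · linear_combination (1 + 2 * μ) / 2 * hA + hq2 / 2
  · exfalso
    have hq2 : (1 + 2 * μ) * (1 + μ) * q = 2 * μ ^ 2 * (1 + 2 * μ) + 2 * μ * T := by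
      apply mul_left_cancel₀ hTne
      linear_combination (1 + 2 * μ) * (1 + μ) * hL - μ ^ 2 * (1 + 2 * μ) * hB - 2 * μ * hT
    have h4 : (1 + 2 * μ) * (1 + μ) * ((p - q) / 2) =
        -2 * μ ^ 2 * (1 + 2 * μ) - (1 + 3 * μ) * T := by
      linear_combination (1 + 2 * μ) / 2 * hB - hq2 / 2
    have h5 : (1 + 2 * μ) * (1 + μ) * -μ < (1 + 2 * μ) * (1 + μ) * ((p - q) / 2) :=
      mul_lt_mul_of_pos_left h3 (mul_pos (by linarith) (by linarith))
    rw [h4] at h5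
    nlinarith [mul_nonneg (sub_nonneg.2 hμ1) (sub_nonneg.2 hTpos.le)]

/-- The two linear equations for the vector `v₈`, solved. -/
lemma step_bc (μ T b c : ℝ) (hμ1 : 0.6 ≤ μ) (hμ2 : μ ≤ 0.64759)
    (hT : T ^ 2 = (1 + 2 * μ) * (1 + μ - 3 * μ ^ 2 - μ ^ 3) / 2)
    (E18 : ((μ + 4*μ^2 + 2*μ^3 - 9*μ^4 - 10*μ^5) + (-μ^2 - 3*μ^3 - 2*μ^4)*c + (-μ - 4*μ^2 - 3*μ^3 + 2*μ^4)*b + (-μ - μ^2 + 2*μ^3)*T + (1 + 3*μ + 2*μ^2)*T*c + ((-2)*μ - 4*μ^2)*T*b) = 0)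
    (E48 : ((-μ - 3*μ^2 - μ^3 + 3*μ^4 + 2*μ^5) + (4*μ^3 + 8*μ^4)*c + (1 + 3*μ - 3*μ^2 - 11*μ^3 - 2*μ^4)*b + (4*μ^2 + 4*μ^3)*T + (4*μ^2)*T*c + (4*μ^2)*T*b) = 0) :
    ((1 + 4*μ + 2*μ^2 + 13*μ^4 + 12*μ^5)*(5*μ^2 - 1)) * b = ((-μ - 4*μ^2 - 5*μ^3 - 3*μ^5 - 36*μ^6 + 9*μ^7 + 104*μ^8) + (4*μ^2 + 16*μ^3 - 8*μ^4 - 16*μ^5 + 68*μ^6)*T) ∧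
    (1 + 4*μ + 2*μ^2 + 13*μ^4 + 12*μ^5) * c = ((μ + 4*μ^2 - 4*μ^3 - 6*μ^4 + 19*μ^5 + 2*μ^6) + ((-2)*μ - 2*μ^2 + 2*μ^3 - 14*μ^4)*T) := by
  have hne : (1 - μ) * (1 + 2 * μ) * (1 + 2 * μ) * (1 + μ) ≠ 0 := by
    apply mul_ne_zero (mul_ne_zero (mul_ne_zero _ _) _) <;> linarith
  constructor
  · apply mul_left_cancel₀ hne
    linear_combination ((4*μ^2 + 8*μ^3 - 16*μ^4 - 32*μ^5 - 20*μ^6 - 40*μ^7) + (8*μ^3 - 40*μ^5)*T) * E18 + (((-1) - 5*μ - 4*μ^2 + 14*μ^3 + 19*μ^4 - 17*μ^5 - 38*μ^6 - 16*μ^7) + (4*μ^2 + 16*μ^3 + 20*μ^4 + 8*μ^5)*T) * E48 + (((-8)*μ^4 - 72*μ^5 - 200*μ^6 - 152*μ^7 + 48*μ^8) + ((-8)*μ^3 - 40*μ^4 - 40*μ^5 + 40*μ^6 + 48*μ^7)*c + ((-32)*μ^5 - 160*μ^6 - 192*μ^7)*b) * hT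
  · apply mul_left_cancel₀ hne
    linear_combination ((2*μ^2 - 4*μ^3 - 18*μ^4 - 4*μ^5) + (2 + 4*μ - 2*μ^2 + 4*μ^3)*T) * E18 + ((2*μ + 8*μ^2 + 8*μ^3 - 2*μ^4 - 4*μ^5) + (2*μ + 6*μ^2 + 4*μ^3)*T) * E48 + ((2*μ + 6*μ^2 - 10*μ^3 - 38*μ^4 - 32*μ^5 - 24*μ^6) + ((-2) - 10*μ - 14*μ^2 - 14*μ^3 - 32*μ^4 - 24*μ^5)*c + (4*μ + 16*μ^2 + 4*μ^3 - 24*μ^4)*b) * hT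

/-- Positivity of the extraneous factors. -/
lemma step_pos (μ : ℝ) (hμ1 : 0.6 ≤ μ) (hμ2 : μ ≤ 0.64759) :
    0 < 5 * μ ^ 2 - 1 ∧ 0 < 1 + μ ∧
    0 < 1 - 2 * μ ^ 2 + 8 * μ ^ 3 + μ ^ 4 - 8 * μ ^ 5 + 16 * μ ^ 6 ∧
    0 < 1 + 8 * μ + 12 * μ ^ 2 - 24 * μ ^ 3 + 6 * μ ^ 4 + 152 * μ ^ 5 - 52 * μ ^ 6
      - 136 * μ ^ 7 + 289 * μ ^ 8 := by
  have hμ0 : 0 < μ := by linarith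
  have p1 : 0 < 5 * μ ^ 2 - 1 := by nlinarith
  have p2 : 0 < 1 + μ := by linarith
  have b2 : μ ^ 2 ≤ 0.42 := by nlinarith
  have p3 : 0 < 1 - 2 * μ ^ 2 + 8 * μ ^ 3 + μ ^ 4 - 8 * μ ^ 5 + 16 * μ ^ 6 := by
    have : 0 < μ ^ 3 * (1 - μ ^ 2) := mul_pos (by positivity) (by linarith)
    have : 0 < μ ^ 4 := by positivity
    have : 0 < μ ^ 6 := by positivity
    linarith
  have p4 : 0 < 1 + 8 * μ + 12 * μ ^ 2 - 24 * μ ^ 3 + 6 * μ ^ 4 + 152 * μ ^ 5 - 52 * μ ^ 6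
      - 136 * μ ^ 7 + 289 * μ ^ 8 := by
    have h1 : 0 ≤ μ * (0.42 - μ ^ 2) := mul_nonneg hμ0.le (by linarith)
    have h0 : 0 ≤ μ * (μ - 0.6) := mul_nonneg hμ0.le (by linarith)
    have h2 : 0 < μ ^ 5 * (1 - μ) := mul_pos (by positivity) (by linarith)
    have h3 : 0 ≤ μ ^ 5 * (0.42 - μ ^ 2) := mul_nonneg (by positivity) (by linarith)
    have : 0 < μ ^ 4 := by positivity
    have : 0 < μ ^ 5 := by positivity
    have : 0 < μ ^ 8 := by positivity
    linarith
  exact ⟨p1, p2, p3, p4⟩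

/-- The norm equation for `v₈` gives the polynomial. -/
lemma step_final (μ T b c : ℝ) (hμ1 : 0.6 ≤ μ) (hμ2 : μ ≤ 0.64759)
    (hT : T ^ 2 = (1 + 2 * μ) * (1 + μ - 3 * μ ^ 2 - μ ^ 3) / 2)
    (hb : ((1 + 4*μ + 2*μ^2 + 13*μ^4 + 12*μ^5)*(5*μ^2 - 1)) * b = ((-μ - 4*μ^2 - 5*μ^3 - 3*μ^5 - 36*μ^6 + 9*μ^7 + 104*μ^8) + (4*μ^2 + 16*μ^3 - 8*μ^4 - 16*μ^5 + 68*μ^6)*T))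
    (hc : (1 + 4*μ + 2*μ^2 + 13*μ^4 + 12*μ^5) * c = ((μ + 4*μ^2 - 4*μ^3 - 6*μ^4 + 19*μ^5 + 2*μ^6) + ((-2)*μ - 2*μ^2 + 2*μ^3 - 14*μ^4)*T))
    (N8 : (1 - μ) * (1 + 2 * μ) * 1 = (1 + 2 * μ) * (-μ * -μ + b * b + c * c)
      - μ * (-μ + b + c) * (-μ + b + c)) :
    1 + 5 * μ - 8 * μ ^ 2 - 80 * μ ^ 3 - 78 * μ ^ 4 + 146 * μ ^ 5 - 80 * μ ^ 6
      - 584 * μ ^ 7 + 677 * μ ^ 8 + 1537 * μ ^ 9 = 0 := by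
  obtain ⟨d, hd⟩ : ∃ d, d = ((1 + 4*μ + 2*μ^2 + 13*μ^4 + 12*μ^5)*(5*μ^2 - 1)) := ⟨_, rfl⟩
  obtain ⟨nb, hnb⟩ : ∃ nb, nb = ((-μ - 4*μ^2 - 5*μ^3 - 3*μ^5 - 36*μ^6 + 9*μ^7 + 104*μ^8) + (4*μ^2 + 16*μ^3 - 8*μ^4 - 16*μ^5 + 68*μ^6)*T) := ⟨_, rfl⟩
  obtain ⟨nc, hnc⟩ : ∃ nc, nc = (5*μ^2 - 1) * ((μ + 4*μ^2 - 4*μ^3 - 6*μ^4 + 19*μ^5 + 2*μ^6) + ((-2)*μ - 2*μ^2 + 2*μ^3 - 14*μ^4)*T) := ⟨_, rfl⟩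
  have hb' : d * b = nb := by rw [hd, hnb, hb]
  have hc' : d * c = nc := by rw [hd, hnc, ← hc]; ring
  have h1 : (1 - μ) * (1 + 2 * μ) * d ^ 2 - ((1 + 2 * μ) * (μ ^ 2 * d ^ 2 + nb ^ 2 + nc ^ 2)
      - μ * (nb + nc - μ * d) ^ 2) = 0 := by
    rw [← hb', ← hc']; linear_combination d ^ 2 * N8
  have hk : (1 - μ) * (1 + 2 * μ) ≠ 0 := by apply mul_ne_zero <;> linarith
  have h2 : (1 + 8*μ + 5*μ^2 - 100*μ^3 - 191*μ^4 + 316*μ^5 + 317*μ^6 - 2264*μ^7 - 773*μ^8 + 6336*μ^9 - 2889*μ^10 - 11348*μ^11 + 11843*μ^12 + 7612*μ^13 - 12409*μ^14 + 3536*μ^15) + (4*μ^2 + 28*μ^3 + 28*μ^4 - 60*μ^5 + 360*μ^6 + 984*μ^7 - 776*μ^8 + 712*μ^9 + 6484*μ^10 - 2228*μ^11 - 2004*μ^12 + 12852*μ^13) * T = 0 := by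
    apply (mul_eq_zero.1 _).resolve_left hk
    rw [hd, hnb, hnc] at h1
    linear_combination h1 - (((-4)*μ^2 - 12*μ^3 + 36*μ^4 + 12*μ^5 - 552*μ^6 - 120*μ^7 + 1736*μ^8 - 3432*μ^9 - 7060*μ^10 + 6212*μ^11 - 2348*μ^12 - 19044*μ^13)) * hT
  obtain ⟨p1, p2, p3, p4⟩ := step_pos μ hμ1 hμ2
  have h3 : ((5 * μ ^ 2 - 1) ^ 2 * (1 + μ) ^ 3 *
      (1 - 2 * μ ^ 2 + 8 * μ ^ 3 + μ ^ 4 - 8 * μ ^ 5 + 16 * μ ^ 6) *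
      (1 + 8 * μ + 12 * μ ^ 2 - 24 * μ ^ 3 + 6 * μ ^ 4 + 152 * μ ^ 5 - 52 * μ ^ 6
      - 136 * μ ^ 7 + 289 * μ ^ 8)) *
      (1 + 5 * μ - 8 * μ ^ 2 - 80 * μ ^ 3 - 78 * μ ^ 4 + 146 * μ ^ 5 - 80 * μ ^ 6
      - 584 * μ ^ 7 + 677 * μ ^ 8 + 1537 * μ ^ 9) = 0 := by
    linear_combination ((1 + 8*μ + 5*μ^2 - 100*μ^3 - 191*μ^4 + 316*μ^5 + 317*μ^6 - 2264*μ^7 - 773*μ^8 + 6336*μ^9 - 2889*μ^10 - 11348*μ^11 + 11843*μ^12 + 7612*μ^13 - 12409*μ^14 + 3536*μ^15) - (4*μ^2 + 28*μ^3 + 28*μ^4 - 60*μ^5 + 360*μ^6 + 984*μ^7 - 776*μ^8 + 712*μ^9 + 6484*μ^10 - 2228*μ^11 - 2004*μ^12 + 12852*μ^13) * T) * h2 + (4*μ^2 + 28*μ^3 + 28*μ^4 - 60*μ^5 + 360*μ^6 + 984*μ^7 - 776*μ^8 + 712*μ^9 + 6484*μ^10 - 2228*μ^11 - 2004*μ^12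 + 12852*μ^13) ^ 2 * hT
  exact (mul_eq_zero.1 h3).resolve_left (by positivity)

/-- If `G(μ, a₁, …, a₁₄)` has rank at most 3, `0.6 ≤ μ ≤ 0.64759`, and `|aⱼ| < μ` for all
`j`, then `μ` is a root of the degree-9 polynomial from the paper. -/
theorem coherence_poly_root
    (μ a1 a2 a3 a4 a5 a6 a7 a8 a9 a10 a11 a12 a13 a14 : ℝ)
    (hrank : (packingGram μ a1 a2 a3 a4 a5 a6 a7 a8 a9 a10 a11 a12 a13 a14).rank ≤ 3)
    (hμ1 : (0.6 : ℝ) ≤ μ) (hμ2 : μ ≤ 0.64759)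
    (h1 : |a1| < μ) (h2 : |a2| < μ) (h3 : |a3| < μ) (h4 : |a4| < μ) (h5 : |a5| < μ)
    (h6 : |a6| < μ) (h7 : |a7| < μ) (h8 : |a8| < μ) (h9 : |a9| < μ) (h10 : |a10| < μ)
    (h11 : |a11| < μ) (h12 : |a12| < μ) (h13 : |a13| < μ) (h14 : |a14| < μ) :
    1 + 5 * μ - 8 * μ ^ 2 - 80 * μ ^ 3 - 78 * μ ^ 4 + 146 * μ ^ 5 - 80 * μ ^ 6
      - 584 * μ ^ 7 + 677 * μ ^ 8 + 1537 * μ ^ 9 = 0 := by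
  have hμ0 : 0 < μ := by linarith
  have hμlt : μ < 1 := by linarith
  have hne : 1 - μ ≠ 0 := by linarith
  rw [abs_lt] at h3 h5 h6 h11
  have key := fun i j => minor_eq_zero _ hrank ![4, 5, 6, i] ![4, 5, 6, j]
  have E11 := bordered μ (a3) (-μ) (a4) (a3) (-μ) (a4) (1) hne (by
    rw [← key 0 0]
    congr 1
    ext r s
    fin_cases r <;> fin_cases s <;> rfl)
  have E22 := bordered μ (-μ) (a6) (-μ) (-μ) (a6) (-μ) (1) hne (by
    rw [← key 1 1]
    congr 1
    ext r s
    fin_cases r <;> fin_cases s <;> rfl)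
  have E33 := bordered μ (a8) (-μ) (a9) (a8) (-μ) (a9) (1) hne (by
    rw [← key 2 2]
    congr 1
    ext r s
    fin_cases r <;> fin_cases s <;> rfl)
  have E44 := bordered μ (a11) (a12) (μ) (a11) (a12) (μ) (1) hne (by
    rw [← key 3 3]
    congr 1
    ext r s
    fin_cases r <;> fin_cases s <;> rfl)
  have E88 := bordered μ (-μ) (a13) (a14) (-μ) (a13) (a14) (1) hne (by
    rw [← key 7 7]
    congr 1
    ext r s
    fin_cases r <;> fin_cases s <;> rfl)
  have E23 := bordered μ (-μ) (a6) (-μ) (a8) (-μ) (a9) (-μ) hne (by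
    rw [← key 1 2]
    congr 1
    ext r s
    fin_cases r <;> fin_cases s <;> rfl)
  have E34 := bordered μ (a8) (-μ) (a9) (a11) (a12) (μ) (μ) hne (by
    rw [← key 2 3]
    congr 1
    ext r s
    fin_cases r <;> fin_cases s <;> rfl)
  have E24 := bordered μ (-μ) (a6) (-μ) (a11) (a12) (μ) (a5) hne (by
    rw [← key 1 3]
    congr 1
    ext r s
    fin_cases r <;> fin_cases s <;> rfl)
  have E13 := bordered μ (a3) (-μ) (a4) (a8) (-μ) (a9) (μ) hne (by
    rw [← key 0 2]
    congr 1
    ext r s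
    fin_cases r <;> fin_cases s <;> rfl)
  have E18 := bordered μ (a3) (-μ) (a4) (-μ) (a13) (a14) (-μ) hne (by
    rw [← key 0 7]
    congr 1
    ext r s
    fin_cases r <;> fin_cases s <;> rfl)
  have E48 := bordered μ (a11) (a12) (μ) (-μ) (a13) (a14) (μ) hne (by
    rw [← key 3 7]
    congr 1
    ext r s
    fin_cases r <;> fin_cases s <;> rfl)
  have h6' := step_a6 μ a6 (by linarith) E22
  obtain rfl := step_a8 μ a6 a8 a9 hμ0 (by linarith) h6' E23
  have hT := step_T μ a9 E33
  obtain ⟨T, ht⟩ : ∃ T, T = (1 + 2 * μ) * a9 := ⟨_, rfl⟩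
  rw [← ht] at hT
  obtain ⟨h11', h12'⟩ := step_a11 μ a9 T a6 a11 a12 hμ0 hμlt h11.2.ne ht hT h6' E34 E44
  have hTpos := step_sign μ T a5 a6 a11 a12 hμ1 hμ2 h5.1 hT h6' h11' h12' E24
  obtain ⟨h3', h4'⟩ := step_a3 μ a9 T a3 a4 hμ1 hμ2 h3.1 ht hTpos hT E13 E11
  obtain ⟨hb, hc⟩ := step_bc μ T a13 a14 hμ1 hμ2 hT
    (by linear_combination -(1 + 2 * μ) * (1 + μ) * E18
          + (1 + μ) * ((1 + 2 * μ) * μ + μ * (a13 + a14 - μ)) * h3'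
          - ((1 + 2 * μ) * a14 - μ * (a13 + a14 - μ)) * h4')
    (by linear_combination -(1 + μ) ^ 2 * E48
          + ((1 + 2 * μ) * μ + μ * (a13 + a14 - μ)) * h11'
          - (1 + μ) * ((1 + 2 * μ) * a13 - μ * (a13 + a14 - μ)) * h12')
  exact step_final μ T a13 a14 hμ1 hμ2 hT hb hc E88
end

section
/- Suppose real numbers μ, a_1, …, a_14 are such that the 8 × 8 symmetric matrix G(μ, a_1, …, a_14) has rank at most 3, 0.6 ≤ μ ≤ 0.64759, and |a_j| < μ for all 1 ≤ j ≤ 14. Then a_1 = (−μ − a_8 μ − 4 a_3 a_8 μ + 2 a_8² μ + 3μ² − a_8 μ² − 2μ³)/(−1 + a_8 + 2 a_8² + μ + a_8 μ). -/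
theorem row_dep (G : Matrix (Fin 8) (Fin 8) ℝ) (h : G.rank ≤ 3) (f : Fin 4 → Fin 8) :
    ∃ k : Fin 4 → ℝ, k ≠ 0 ∧ ∀ j, ∑ i, k i * G (f i) j = 0 := by
  by_contra hcon
  have hli : LinearIndependent ℝ (fun i => G.row (f i)) := by
    rw [Fintype.linearIndependent_iff]
    intro k hk i
    by_contra hi
    refine hcon ⟨k, fun h0 => hi (by rw [h0]; rfl), fun j => ?_⟩
    have := congrFun hk j
    simpa [Finset.sum_apply, Matrix.row] using this
  have h1 := finrank_span_eq_card hli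
  rw [Matrix.rank_eq_finrank_span_row] at h
  have h2 : Submodule.span ℝ (Set.range (fun i => G.row (f i))) ≤
      Submodule.span ℝ (Set.range G.row) := by
    apply Submodule.span_mono
    rintro _ ⟨i, rfl⟩
    exact ⟨f i, rfl⟩
  have h3 := Submodule.finrank_mono h2
  simp at h1
  omega

theorem det_four (M : Matrix (Fin 4) (Fin 4) ℝ) : M.det =
    M 0 0 * (M 1 1 * (M 2 2 * M 3 3 - M 2 3 * M 3 2) - M 1 2 * (M 2 1 * M 3 3 - M 2 3 * M 3 1)
      + M 1 3 * (M 2 1 * M 3 2 - M 2 2 * M 3 1))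
    - M 0 1 * (M 1 0 * (M 2 2 * M 3 3 - M 2 3 * M 3 2) - M 1 2 * (M 2 0 * M 3 3 - M 2 3 * M 3 0)
      + M 1 3 * (M 2 0 * M 3 2 - M 2 2 * M 3 0))
    + M 0 2 * (M 1 0 * (M 2 1 * M 3 3 - M 2 3 * M 3 1) - M 1 1 * (M 2 0 * M 3 3 - M 2 3 * M 3 0)
      + M 1 3 * (M 2 0 * M 3 1 - M 2 1 * M 3 0))
    - M 0 3 * (M 1 0 * (M 2 1 * M 3 2 - M 2 2 * M 3 1) - M 1 1 * (M 2 0 * M 3 2 - M 2 2 * M 3 0)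
      + M 1 2 * (M 2 0 * M 3 1 - M 2 1 * M 3 0)) := by
  rw [Matrix.det_succ_row_zero]
  simp [Fin.sum_univ_succ, Matrix.det_fin_three, Fin.succAbove]
  ring

theorem minor_zero (G : Matrix (Fin 8) (Fin 8) ℝ) (h : G.rank ≤ 3) (f g : Fin 4 → Fin 8) :
    (G.submatrix f g).det = 0 := by
  obtain ⟨k, hk, hk2⟩ := row_dep G h f
  refine Matrix.exists_vecMul_eq_zero_iff.mp ⟨k, hk, ?_⟩
  ext j
  simpa [Matrix.vecMul, dotProduct] using hk2 (g j)

set_option maxHeartbeats 2000000 in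
/-- **Step 6.** Under the rank-3 and coherence conditions on `G`, the coefficient `a₁` is determined as a rational expression in `μ`, `a₃`, `a₈`. -/
theorem step6
    (μ a1 a2 a3 a4 a5 a6 a7 a8 a9 a10 a11 a12 a13 a14 : ℝ)
    (hrank : (packingGram μ a1 a2 a3 a4 a5 a6 a7 a8 a9 a10 a11 a12 a13 a14).rank ≤ 3)
    (hμ1 : (0.6 : ℝ) ≤ μ) (hμ2 : μ ≤ 0.64759)
    (h1 : |a1| < μ) (h2 : |a2| < μ) (h3 : |a3| < μ) (h4 : |a4| < μ) (h5 : |a5| < μ)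
    (h6 : |a6| < μ) (h7 : |a7| < μ) (h8 : |a8| < μ) (h9 : |a9| < μ) (h10 : |a10| < μ)
    (h11 : |a11| < μ) (h12 : |a12| < μ) (h13 : |a13| < μ) (h14 : |a14| < μ) :
    a1 = (-μ - a8 * μ - 4 * a3 * a8 * μ + 2 * a8 ^ 2 * μ + 3 * μ ^ 2 - a8 * μ ^ 2 - 2 * μ ^ 3) / (-1 + a8 + 2 * a8 ^ 2 + μ + a8 * μ) := by
  have hA := minor_zero _ hrank ![1, 2, 4, 6] ![1, 2, 4, 6]
  have hB := minor_zero _ hrank ![2, 4, 5, 6] ![2, 4, 5, 6]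
  have hC := minor_zero _ hrank ![0, 1, 4, 5] ![0, 1, 4, 5]
  have hE := minor_zero _ hrank ![0, 1, 4, 5] ![6, 1, 4, 5]
  obtain ⟨k, hk, hk2⟩ := row_dep _ hrank ![1, 2, 4, 5]
  have c1 := hk2 0
  have c2 := hk2 1
  have c3 := hk2 2
  have c5 := hk2 4
  have c6 := hk2 5
  have c7 := hk2 6
  clear hk2 hrank
  rw [det_four] at hA hB hC hE
  simp [packingGram] at hA hB hC hE
  simp [Fin.sum_univ_succ, packingGram] at c1 c2 c3 c5 c6 c7
  have hkne : k 0 = 0 → k 1 = 0 → k 2 = 0 → k 3 = 0 → False := by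
    intro e0 e1 e2 e3
    apply hk
    ext i
    fin_cases i <;> simp [e0, e1, e2, e3]
  generalize k 0 = x at *
  generalize k 1 = p at *
  generalize k 2 = q at *
  generalize k 3 = y at *
  norm_num at hμ1 hμ2
  rw [abs_lt] at h1 h4 h8
  have hμ0 : 0 < μ := by linarith
  have h9' : a9 = -a8 := by
    have : 4 * μ ^ 2 * (1 - μ) * (a8 + a9) = 0 := by linear_combination hA - hB
    have h' : 4 * μ ^ 2 * (1 - μ) ≠ 0 := by
      have : 0 < 1 - μ := by linarith
      positivity
    have := (mul_eq_zero.mp this).resolve_left h'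
    linarith
  subst h9'
  have hp8 : 1 + a8 ≠ 0 := by intro h; linarith
  have hm8 : 1 - a8 ≠ 0 := by intro h; linarith
  have eP : (1 + a8) * (p + q) = 2 * μ * x := by linear_combination c3 + c5
  have eQ : (1 - a8) * (p - q) = 2 * μ * y := by linear_combination c3 - c5
  have e7 : (μ - 1 - 2 * a8) * (p + q) + (1 - 2 * a8 - μ) * (p - q) = 0 := by
    linear_combination 2 * c7 - eP + eQ
  by_cases hD : 1 - 2 * a8 - μ = 0
  · exfalso
    have ha8 : a8 = (1 - μ) / 2 := by linarith
    have hPz : p + q = 0 := by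
      have : (μ - 1) * (p + q) = 0 := by
        rw [hD] at e7
        subst ha8
        linear_combination e7 / 2
      exact (mul_eq_zero.mp this).resolve_left (by intro h; linarith)
    have hx : x = 0 := by
      rw [hPz] at eP
      have : μ * x = 0 := by linarith
      exact (mul_eq_zero.mp this).resolve_left hμ0.ne'
    subst hx
    have hq : q = -p := by linarith
    subst hq
    have hy : y ≠ 0 := by
      intro hy
      subst hy
      have : (1 - a8) * p = 0 := by linarith
      have hp := (mul_eq_zero.mp this).resolve_left hm8
      exact hkne rfl hp (by simp [hp]) rfl
    have ha6 : a6 = 0 := by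
      have : a6 * y = 0 := by linear_combination c2
      exact (mul_eq_zero.mp this).resolve_right hy
    have hyp : y = 2 * μ * p := by linear_combination c6
    have hp : p ≠ 0 := by
      rintro rfl
      apply hy
      simp [hyp]
    have hμq : 1 - a8 = 2 * μ ^ 2 := by
      apply mul_right_cancel₀ hp
      rw [hyp] at eQ
      linear_combination eQ / 2
    have ha3 : a3 = μ - 2 * μ ^ 2 := by
      apply mul_right_cancel₀ hp
      rw [hyp] at c1
      linear_combination -c1
    have hμ2' : μ ^ 2 = (1 + μ) / 4 := by
      rw [ha8] at hμq
      linarith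
    have ha3' : a3 = (μ - 1) / 2 := by rw [ha3, hμ2']; ring
    subst ha6
    rw [ha3'] at hC hE
    have ha1 : a1 = μ - 1 / 2 := by
      have : (a1 + μ) * (a1 - (μ - 1 / 2)) = 0 := by
        clear hA hB hE hk hkne h2 h3 h5 h6 h7 h9 h10 h11 h12 h13 h14 c1 c2 c3 c5 c6 c7 eP eQ e7 hyp
        grind
      have := (mul_eq_zero.mp this).resolve_left (by intro h; linarith)
      linarith
    rw [ha1] at hE
    have : (a4 + μ ^ 2) * (1 - 2 * μ ^ 2) - (μ - 1 / 2) * (-μ * (1 - μ ^ 2) + μ ^ 2 * (1 - μ))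
        + (μ - μ ^ 2) * (μ ^ 2 - μ + μ ^ 2) = 0 := by
      clear hA hB hC hk hkne h2 h3 h5 h6 h7 h9 h10 h11 h12 h13 h14 c1 c2 c3 c5 c6 c7 eP eQ e7 hyp
      grind
    nlinarith
  · have hx : x ≠ 0 := by
      rintro rfl
      have hP : p + q = 0 := by
        have : (1 + a8) * (p + q) = 0 := by linarith
        exact (mul_eq_zero.mp this).resolve_left hp8
      rw [hP] at e7
      have hQ : p - q = 0 := by
        have : (1 - 2 * a8 - μ) * (p - q) = 0 := by linarith
        exact (mul_eq_zero.mp this).resolve_left hD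
      rw [hQ] at eQ
      have hy : μ * y = 0 := by linarith
      exact hkne rfl (by linarith) (by linarith) ((mul_eq_zero.mp hy).resolve_left hμ0.ne')
    have hden : -1 + a8 + 2 * a8 ^ 2 + μ + a8 * μ ≠ 0 := by
      have := mul_ne_zero hp8 hD
      intro h
      apply this
      linear_combination -h
    rw [eq_div_iff hden]
    apply mul_right_cancel₀ hx
    have c1' : 2 * a1 * x + (μ + a3) * (p + q) + (μ - a3 - (1 - a8)) * (p - q) = 0 := by
      linear_combination 2 * c1 - eQ
    linear_combination (-(1 + a8) * (1 - 2 * a8 - μ) / 2) * c1' + ((μ + a3) * (1 - 2 * a8 - μ) / 2 - (μ - a3 - (1 - a8)) * (μ - 1 - 2 * a8) / 2) * eP + ((1 + a8) * (μ - a3 - (1 - a8)) / 2) * e7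
end
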